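/- arXiv:2502.14490 — 3 statements merged into one kernel-verified Lean document; each statement's English description precedes it below -/
import Mathlib

section
/- Let 1 < p ≤ 2 with conjugate exponent q = p/(p−1), and let f : ℂ → ℂ be holomorphic on the open right half-plane Π₊ = {z ∈ ℂ : 0 < Re z} with M := (∫_0^∞ ∫_ℝ |f(u+iv)|^p dv du)^{1/p} < ∞. Then there exists a measurable function g : (-∞,0) → ℂ such that f(z) = (1/√(2π)) ∫_{-∞}^0 e^{zw} g(w) dw for every z with Re z > 0, and (∫_{-∞}^0 (1/(−pw))^{q/p} |g(w)|^q dw)^{1/q} ≤ M. -/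
open MeasureTheory Set
open scoped ENNReal NNReal

section FourierBergman

open Filter Real
open scoped Topology FourierTransform ContDiff

/-- The Fourier transform of an integrable function is continuous. -/
lemma continuous_fourier_of_integrable {φ : ℝ → ℂ} (hφ : Integrable φ) : Continuous (𝓕 φ) :=
  VectorFourier.fourierIntegral_continuous Real.continuous_fourierChar
    (by simpa using! continuous_snd.mul continuous_fst) hφ

lemma norm_fourier_le_integral_norm (φ : ℝ → ℂ) (ξ : ℝ) : ‖𝓕 φ ξ‖ ≤ ∫ x, ‖φ x‖ :=
  VectorFourier.norm_fourierIntegral_le_integral_norm _ _ _ _ _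

/-- Plancherel's theorem for functions in `L¹ ∩ L²`. -/
lemma eLpNorm_fourier_eq {φ : ℝ → ℂ} (h1 : Integrable φ) (h2 : MemLp φ 2) :
    eLpNorm (𝓕 φ) 2 = eLpNorm φ 2 := by
  set Φ : Lp ℂ 2 (volume : Measure ℝ) := h2.toLp φ with hΦ
  have key : ∀ᵐ x, (𝓕 Φ : Lp ℂ 2 (volume : Measure ℝ)) x = 𝓕 φ x := by
    apply ae_eq_of_integral_contDiff_smul_eq
    · exact (Lp.memLp _).locallyIntegrable (by norm_num)
    · exact (continuous_fourier_of_integrable h1).locallyIntegrable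
    · intro g hg hgc
      have hg' : ContDiff ℝ ∞ (fun x => (g x : ℂ)) := Complex.ofRealCLM.contDiff.comp hg
      have hgc' : HasCompactSupport (fun x => (g x : ℂ)) :=
        hgc.comp_left (g := fun x : ℝ => (x : ℂ)) (by simp)
      let η : SchwartzMap ℝ ℂ := hgc'.toSchwartzMap hg'
      have hη : ∀ x, η x = (g x : ℂ) := fun x => rfl
      have e1 : (𝓕 (Φ : TemperedDistribution ℝ ℂ)) η
          = ((𝓕 Φ : Lp ℂ 2 (volume : Measure ℝ)) : TemperedDistribution ℝ ℂ) η := by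
        rw [Lp.fourier_toTemperedDistribution_eq]
      rw [TemperedDistribution.fourier_apply, Lp.toTemperedDistribution_apply,
        Lp.toTemperedDistribution_apply] at e1
      have e2 : ∫ x, g x • (𝓕 Φ : Lp ℂ 2 (volume : Measure ℝ)) x
          = ∫ x, (𝓕 η) x • Φ x := by
        rw [e1]
        refine integral_congr_ae (Eventually.of_forall fun x => ?_)
        simp [hη]
      rw [e2]
      have e3 : ∫ x, (𝓕 η) x • Φ x = ∫ x, φ x • 𝓕 (η : ℝ → ℂ) x := by
        refine integral_congr_ae ?_
        filter_upwards [h2.coeFn_toLp] with x hx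
        rw [hΦ, hx, SchwartzMap.fourier_coe, smul_eq_mul, smul_eq_mul, mul_comm]
      rw [e3]
      have e4 := VectorFourier.integral_fourierIntegral_smul_eq_flip (L := innerₗ ℝ)
        (f := φ) (g := (η : ℝ → ℂ)) (μ := volume) (ν := volume) Real.continuous_fourierChar
        (by simpa using! continuous_snd.mul continuous_fst) h1 η.integrable
      rw [flip_innerₗ] at e4
      refine e4.symm.trans ?_
      refine integral_congr_ae (Eventually.of_forall fun x => ?_)
      change 𝓕 φ x • η x = _
      simp [hη, mul_comm]
  rw [← eLpNorm_congr_ae key, ← eLpNorm_congr_ae h2.coeFn_toLp, ← Lp.enorm_def, ← Lp.enorm_def,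
    ← hΦ, ← ofReal_norm, ← ofReal_norm, Lp.norm_fourier_eq]

/-- A complex exponential integral with a bounded phase is entire in its parameter. -/
lemma differentiable_integral_mul_cexp {α : Type*} [MeasurableSpace α] {μ : Measure α}
    {N : α → ℂ} (hN : Integrable N μ) {Λ : α → ℝ} (hΛ : Measurable Λ) {B : ℝ}
    (hB : ∀ x, |Λ x| ≤ B) :
    Differentiable ℂ (fun t : ℂ => ∫ x, N x * Complex.exp (t * Λ x) ∂μ) := by
  intro t
  have hexp : ∀ s : ℂ, Measurable fun x => Complex.exp (s * Λ x) := fun s => by fun_prop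
  have bd : ∀ x, ∀ s ∈ Metric.ball t 1, ‖Complex.exp (s * Λ x)‖ ≤ Real.exp ((‖t‖ + 1) * B) := by
    intro x s hs
    rw [Complex.norm_exp]
    apply Real.exp_le_exp.2
    have h1 : ‖s‖ ≤ ‖t‖ + 1 := by
      have := norm_sub_norm_le s t
      have h2 := mem_ball_iff_norm.1 hs
      linarith
    have : (s * Λ x).re ≤ ‖s * Λ x‖ := Complex.re_le_norm _
    rw [norm_mul, Complex.norm_real, Real.norm_eq_abs] at this
    refine this.trans ?_
    gcongr
    exact hB x
  refine (hasDerivAt_integral_of_dominated_loc_of_deriv_le (𝕜 := ℂ)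
    (F := fun t x => N x * Complex.exp (t * Λ x))
    (F' := fun t x => N x * (Complex.exp (t * Λ x) * Λ x))
    (bound := fun x => ‖N x‖ * (Real.exp ((‖t‖ + 1) * B) * B))
    (Metric.ball_mem_nhds t one_pos) ?_ ?_ ?_ ?_ ?_ ?_).2.differentiableAt
  · exact Eventually.of_forall fun s => hN.1.mul (hexp s).aestronglyMeasurable
  · refine hN.mul_bdd (c := Real.exp ((‖t‖ + 1) * B)) (hexp t).aestronglyMeasurable ?_
    exact Eventually.of_forall fun x => bd x t (Metric.mem_ball_self one_pos)
  · exact hN.1.mul (by fun_prop)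
  · refine Eventually.of_forall fun x s hs => ?_
    rw [norm_mul, norm_mul, Complex.norm_real, Real.norm_eq_abs]
    have := bd x s hs
    have := hB x
    gcongr
  · exact hN.norm.mul_const _
  · refine Eventually.of_forall fun x s _ => ?_
    have h := ((hasDerivAt_id s).mul_const (Λ x : ℂ)).cexp.const_mul (N x)
    simpa using h

lemma memLp_fourier_two {φ : ℝ → ℂ} (h1 : Integrable φ) (h2 : MemLp φ 2) :
    MemLp (𝓕 φ) 2 :=
  ⟨(continuous_fourier_of_integrable h1).aestronglyMeasurable, by
    rw [eLpNorm_fourier_eq h1 h2]; exact h2.2⟩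

lemma integral_norm_fourier_rpow_two {φ : ℝ → ℂ} (h1 : Integrable φ) (h2 : MemLp φ 2) :
    ∫ ξ, ‖𝓕 φ ξ‖ ^ (2 : ℝ) = ∫ x, ‖φ x‖ ^ (2 : ℝ) := by
  have h := eLpNorm_fourier_eq h1 h2
  rw [(memLp_fourier_two h1 h2).eLpNorm_eq_integral_rpow_norm (by norm_num) (by norm_num),
    h2.eLpNorm_eq_integral_rpow_norm (by norm_num) (by norm_num),
    ENNReal.ofReal_eq_ofReal_iff (by positivity) (by positivity)] at h
  simp only [ENNReal.toReal_ofNat] at h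
  exact (Real.rpow_left_inj (integral_nonneg fun x => by positivity)
    (integral_nonneg fun x => by positivity) (by norm_num)).1 h

/-- The function with the same argument as `φ` and with modulus `‖φ‖ ^ (1 + t)`. -/
noncomputable def expTwist (φ : ℝ → ℂ) (t : ℂ) (x : ℝ) : ℂ :=
  φ x * Complex.exp (t * (Real.log ‖φ x‖ : ℝ))

lemma norm_expTwist (φ : ℝ → ℂ) {t : ℂ} (ht : 0 < 1 + t.re) (x : ℝ) :
    ‖expTwist φ t x‖ = ‖φ x‖ ^ (1 + t.re) := by
  unfold expTwist
  by_cases h : φ x = 0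
  · simp [h, Real.zero_rpow ht.ne']
  · have hpos : 0 < ‖φ x‖ := norm_pos_iff.2 h
    rw [norm_mul, Complex.norm_exp, Complex.re_mul_ofReal, mul_comm t.re,
      ← Real.rpow_def_of_pos hpos, Real.rpow_add hpos, Real.rpow_one]

lemma integrable_expTwist {φ : ℝ → ℂ} (hm : Measurable φ) (hφ : Integrable φ) {B : ℝ}
    (hB : ∀ x, |Real.log ‖φ x‖| ≤ B) (t : ℂ) : Integrable (expTwist φ t) := by
  refine hφ.mul_bdd (c := Real.exp (‖t‖ * B)) ?_ ?_
  · exact Measurable.aestronglyMeasurable (by fun_prop)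
  · refine Eventually.of_forall fun x => ?_
    rw [Complex.norm_exp]
    apply Real.exp_le_exp.2
    refine (Complex.re_le_norm _).trans ?_
    rw [norm_mul, Complex.norm_real, Real.norm_eq_abs]
    gcongr
    exact hB x

lemma integrable_norm_rpow {φ : ℝ → ℂ} (hm : Measurable φ) (hφ : Integrable φ) {B : ℝ}
    (hB : ∀ x, |Real.log ‖φ x‖| ≤ B) {r : ℝ} (hr : 0 < r) :
    Integrable (fun x => ‖φ x‖ ^ r) := by
  have h := (integrable_expTwist hm hφ hB ((r - 1 : ℝ) : ℂ)).norm
  refine h.congr (Eventually.of_forall fun x => ?_)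
  change ‖expTwist φ ((r - 1 : ℝ) : ℂ) x‖ = _
  rw [norm_expTwist φ (by rw [Complex.ofReal_re]; linarith), Complex.ofReal_re]
  congr 1; ring

lemma memLp_two_expTwist {φ : ℝ → ℂ} (hm : Measurable φ) (hφ : Integrable φ) {B : ℝ}
    (hB : ∀ x, |Real.log ‖φ x‖| ≤ B) {t : ℂ} (ht : 0 < 1 + t.re) : MemLp (expTwist φ t) 2 := by
  rw [memLp_two_iff_integrable_sq_norm (integrable_expTwist hm hφ hB t).1]
  refine (integrable_norm_rpow hm hφ hB (r := (1 + t.re) * 2) (by positivity)).congr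
    (Eventually.of_forall fun x => ?_)
  change ‖φ x‖ ^ ((1 + t.re) * 2) = ‖expTwist φ t x‖ ^ 2
  rw [norm_expTwist φ ht, Real.rpow_mul (norm_nonneg _), Real.rpow_two]

lemma integrable_prod_fourier_kernel {φ ψ : ℝ → ℂ} (hφ : Integrable φ) (hψ : Integrable ψ) :
    Integrable (fun z : ℝ × ℝ => ψ z.1 * (((𝐞 (-(z.2 * z.1)) : Circle) : ℂ) * φ z.2))
      (volume.prod volume) := by
  have h := hψ.mul_prod hφ
  have h2 := h.bdd_mul (c := 1) (f := fun z : ℝ × ℝ => ((𝐞 (-(z.2 * z.1)) : Circle) : ℂ))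
    (Continuous.aestronglyMeasurable (by fun_prop)) (Eventually.of_forall fun z => (Circle.norm_coe _).le)
  refine h2.congr (Eventually.of_forall fun z => ?_)
  simp only
  ring

lemma integral_mul_fourier_eq_prod {φ ψ : ℝ → ℂ} (hφ : Integrable φ) (hψ : Integrable ψ) :
    ∫ ξ, ψ ξ * 𝓕 φ ξ =
      ∫ z : ℝ × ℝ, ψ z.1 * (((𝐞 (-(z.2 * z.1)) : Circle) : ℂ) * φ z.2) ∂(volume.prod volume) := by
  rw [integral_prod _ (integrable_prod_fourier_kernel hφ hψ)]
  refine integral_congr_ae (Eventually.of_forall fun ξ => ?_)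
  simp only [Real.fourier_real_eq, Circle.smul_def, smul_eq_mul]
  rw [integral_const_mul]

lemma norm_integral_mul_fourier_le_L1 {φ ψ : ℝ → ℂ} (hψ : Integrable ψ) :
    ‖∫ ξ, ψ ξ * 𝓕 φ ξ‖ ≤ (∫ x, ‖φ x‖) * ∫ ξ, ‖ψ ξ‖ := by
  rw [mul_comm, ← integral_mul_const]
  refine norm_integral_le_of_norm_le (hψ.norm.mul_const _) (Eventually.of_forall fun ξ => ?_)
  rw [norm_mul]
  gcongr
  exact norm_fourier_le_integral_norm φ ξ

lemma norm_integral_mul_fourier_le_L2 {φ ψ : ℝ → ℂ} (hφ : Integrable φ) (hφ2 : MemLp φ 2)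
    (hψ2 : MemLp ψ 2) :
    ‖∫ ξ, ψ ξ * 𝓕 φ ξ‖ ≤
      (∫ x, ‖φ x‖ ^ (2 : ℝ)) ^ (1 / 2 : ℝ) * (∫ ξ, ‖ψ ξ‖ ^ (2 : ℝ)) ^ (1 / 2 : ℝ) := by
  rw [← integral_norm_fourier_rpow_two hφ hφ2, mul_comm]
  refine (norm_integral_le_integral_norm _).trans ?_
  simp only [norm_mul]
  exact integral_mul_norm_le_Lp_mul_Lq Real.HolderConjugate.two_two
    (by simpa using hψ2) (by simpa using memLp_fourier_two hφ hφ2)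

/-- Interpolation of the Fourier pairing between `L¹ × L¹` and `L² × L²`. -/
lemma norm_integral_mul_fourier_le {p : ℝ} (hp1 : 1 < p) (hp2 : p ≤ 2) {φ ψ : ℝ → ℂ}
    (hφm : Measurable φ) (hψm : Measurable ψ) (hφ : Integrable φ) (hψ : Integrable ψ) {B : ℝ}
    (hφB : ∀ x, |Real.log ‖φ x‖| ≤ B) (hψB : ∀ x, |Real.log ‖ψ x‖| ≤ B) :
    ‖∫ ξ, ψ ξ * 𝓕 φ ξ‖ ≤ ((∫ x, ‖φ x‖ ^ p) * ∫ ξ, ‖ψ ξ‖ ^ p) ^ (1 / p) := by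
  set P := (∫ x, ‖φ x‖ ^ p) with hP
  set Q := (∫ ξ, ‖ψ ξ‖ ^ p) with hQ
  have hP0 : 0 ≤ P := integral_nonneg fun x => by positivity
  have hQ0 : 0 ≤ Q := integral_nonneg fun x => by positivity
  have hB0 : 0 ≤ B := (abs_nonneg _).trans (hφB 0)
  let N : ℝ × ℝ → ℂ := fun z => ψ z.1 * (((𝐞 (-(z.2 * z.1)) : Circle) : ℂ) * φ z.2)
  let Λ : ℝ × ℝ → ℝ := fun z => Real.log ‖ψ z.1‖ + Real.log ‖φ z.2‖
  have hN : Integrable N (volume.prod volume) := integrable_prod_fourier_kernel hφ hψ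
  have hΛ : Measurable Λ := by fun_prop
  have hΛB : ∀ z, |Λ z| ≤ 2 * B := fun z =>
    (abs_add_le _ _).trans (by linarith [hψB z.1, hφB z.2])
  let a : ℂ → ℂ := fun s => p * (1 - s / 2) - 1
  have ha : Differentiable ℂ a := by fun_prop
  have hre : ∀ s, (a s).re = p * (1 - s.re / 2) - 1 := fun s => by
    simp [a]
  let G : ℂ → ℂ := fun s => ∫ z, N z * Complex.exp (a s * Λ z) ∂(volume.prod volume)
  have hG : Differentiable ℂ G := (differentiable_integral_mul_cexp hN hΛ hΛB).comp ha
  have hGeq : ∀ s, G s = ∫ ξ, expTwist ψ (a s) ξ * 𝓕 (expTwist φ (a s)) ξ := by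
    intro s
    rw [integral_mul_fourier_eq_prod (integrable_expTwist hφm hφ hφB _)
      (integrable_expTwist hψm hψ hψB _)]
    refine integral_congr_ae (Eventually.of_forall fun z => ?_)
    simp only [N, Λ, expTwist]
    push_cast
    rw [mul_add, Complex.exp_add]
    ring
  have hG0 : ∀ s ∈ Complex.re ⁻¹' {(0 : ℝ)}, ‖G s‖ ≤ P * Q := by
    intro s hs
    have hs : s.re = 0 := hs
    have h1 : 1 + (a s).re = p := by rw [hre, hs]; ring
    have h1' : 0 < 1 + (a s).re := by rw [h1]; linarith
    rw [hGeq]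
    refine (norm_integral_mul_fourier_le_L1 (integrable_expTwist hψm hψ hψB _)).trans_eq ?_
    simp only [norm_expTwist _ h1', h1, hP, hQ]
  have hG1 : ∀ s ∈ Complex.re ⁻¹' {(1 : ℝ)}, ‖G s‖ ≤ (P * Q) ^ (1 / 2 : ℝ) := by
    intro s hs
    have hs : s.re = 1 := hs
    have h1 : 1 + (a s).re = p / 2 := by rw [hre, hs]; ring
    have h1' : 0 < 1 + (a s).re := by rw [h1]; linarith
    rw [hGeq]
    refine (norm_integral_mul_fourier_le_L2 (integrable_expTwist hφm hφ hφB _)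
      (memLp_two_expTwist hφm hφ hφB h1') (memLp_two_expTwist hψm hψ hψB h1')).trans_eq ?_
    simp only [norm_expTwist _ h1', h1, ← Real.rpow_mul (norm_nonneg _)]
    rw [div_mul_cancel₀ _ (two_ne_zero), ← hP, ← hQ, Real.mul_rpow hP0 hQ0]
  have hbdd : BddAbove ((norm ∘ G) '' Complex.HadamardThreeLines.verticalClosedStrip 0 1) := by
    refine ⟨∫ z, ‖N z‖ * Real.exp (2 * B) ∂(volume.prod volume), ?_⟩
    rintro _ ⟨s, hs, rfl⟩
    have hs : s.re ∈ Icc (0 : ℝ) 1 := hs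
    refine norm_integral_le_of_norm_le (hN.norm.mul_const _) (Eventually.of_forall fun z => ?_)
    rw [norm_mul, Complex.norm_exp, Complex.re_mul_ofReal]
    have h3 : |(a s).re| ≤ 1 := by
      rw [hre, abs_le]
      constructor <;> nlinarith [hs.1, hs.2]
    have h4 : (a s).re * Λ z ≤ 2 * B := by
      refine (le_abs_self _).trans ?_
      rw [abs_mul]
      nlinarith [hΛB z, abs_nonneg (Λ z), abs_nonneg (a s).re]
    gcongr
  have hp0 : 0 < p := by linarith
  set θ : ℝ := 2 * (1 - 1 / p) with hθ
  have h1p : 1 / p < 1 := by rw [div_lt_one hp0]; exact hp1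
  have h2p : 1 / 2 ≤ 1 / p := one_div_le_one_div_of_le hp0 hp2
  have hθmem : ((θ : ℝ) : ℂ) ∈ Complex.HadamardThreeLines.verticalClosedStrip 0 1 := by
    change ((θ : ℝ) : ℂ).re ∈ Icc (0 : ℝ) 1
    rw [Complex.ofReal_re, hθ]
    constructor <;> linarith
  have main := Complex.HadamardThreeLines.norm_le_interp_of_mem_verticalClosedStrip₀₁' G hθmem
    hG.diffContOnCl hbdd hG0 hG1
  have haθ : a θ = 0 := by
    simp only [a, hθ]
    push_cast
    have : (p : ℂ) ≠ 0 := by exact_mod_cast hp0.ne'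
    field_simp
    ring
  rw [hGeq, haθ] at main
  have ht0 : ∀ χ : ℝ → ℂ, expTwist χ 0 = χ := fun χ => by ext x; simp [expTwist]
  rw [ht0, ht0, Complex.ofReal_re, ← Real.rpow_mul (mul_nonneg hP0 hQ0)] at main
  refine main.trans_eq ?_
  rw [← Real.rpow_add_of_nonneg (mul_nonneg hP0 hQ0)]
  · congr 1; rw [hθ]; ring
  · rw [hθ]; linarith
  · rw [hθ]; linarith

lemma lintegral_le_of_tendsto_of_forall_le {α : Type*} [MeasurableSpace α] {μ : Measure α}
    {F : ℕ → α → ℝ≥0∞} {G : α → ℝ≥0∞} {c : ℝ≥0∞} (hF : ∀ n, AEMeasurable (F n) μ)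
    (hlim : ∀ᵐ x ∂μ, Tendsto (fun n => F n x) atTop (𝓝 (G x)))
    (hle : ∀ n, ∫⁻ x, F n x ∂μ ≤ c) : ∫⁻ x, G x ∂μ ≤ c := by
  calc ∫⁻ x, G x ∂μ = ∫⁻ x, liminf (fun n => F n x) atTop ∂μ := by
        refine lintegral_congr_ae ?_
        filter_upwards [hlim] with x hx using hx.liminf_eq.symm
    _ ≤ liminf (fun n => ∫⁻ x, F n x ∂μ) atTop := lintegral_liminf_le' hF
    _ ≤ c := liminf_le_of_frequently_le' (Frequently.of_forall hle)

/-- Minkowski's integral inequality, under an a priori finiteness assumption. -/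
lemma lintegral_rpow_lintegral_le {α β : Type*} [MeasurableSpace α] [MeasurableSpace β]
    {μ : Measure α} {ν : Measure β} [SFinite μ] [SFinite ν] {G : α → β → ℝ≥0∞}
    (hG : Measurable (Function.uncurry G)) {r : ℝ} (hr : 1 ≤ r)
    (hfin : ∫⁻ w, (∫⁻ u, G u w ∂μ) ^ r ∂ν ≠ ⊤) :
    (∫⁻ w, (∫⁻ u, G u w ∂μ) ^ r ∂ν) ^ (1 / r) ≤ ∫⁻ u, (∫⁻ w, G u w ^ r ∂ν) ^ (1 / r) ∂μ := by
  rcases hr.eq_or_lt with rfl | hr1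
  · simp only [ENNReal.rpow_one, div_one]
    rw [lintegral_lintegral_swap]
    exact (hG.comp measurable_swap).aemeasurable
  set H : β → ℝ≥0∞ := fun w => ∫⁻ u, G u w ∂μ with hH
  set X := ∫⁻ w, H w ^ r ∂ν with hX
  have hHm : Measurable H := Measurable.lintegral_prod_left' hG
  have hconj : r.HolderConjugate (Real.conjExponent r) := Real.HolderConjugate.conjExponent hr1
  set r' := Real.conjExponent r with hr'
  have h1 : X ≤ (∫⁻ u, (∫⁻ w, G u w ^ r ∂ν) ^ (1 / r) ∂μ) * X ^ (1 / r') := by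
    calc X = ∫⁻ w, ∫⁻ u, G u w * H w ^ (r - 1) ∂μ ∂ν := by
          refine lintegral_congr fun w => ?_
          rw [lintegral_mul_const _ (show Measurable fun u => G u w from hG.comp measurable_prodMk_right)]
          change H w ^ r = H w * _
          have : r = 1 + (r - 1) := by ring
          conv_lhs => rw [this]
          rw [ENNReal.rpow_add_of_nonneg _ _ zero_le_one (by linarith), ENNReal.rpow_one]
      _ = ∫⁻ u, ∫⁻ w, G u w * H w ^ (r - 1) ∂ν ∂μ := by
          rw [lintegral_lintegral_swap]
          refine Measurable.aemeasurable ?_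
          exact (hG.comp measurable_swap).mul ((hHm.comp measurable_fst).pow_const _)
      _ ≤ ∫⁻ u, (∫⁻ w, G u w ^ r ∂ν) ^ (1 / r) * X ^ (1 / r') ∂μ := by
          refine lintegral_mono fun u => ?_
          have := ENNReal.lintegral_mul_le_Lp_mul_Lq ν hconj
            (f := G u) (g := fun w => H w ^ (r - 1))
            (hG.comp measurable_prodMk_left).aemeasurable (hHm.pow_const _).aemeasurable
          refine this.trans_eq ?_
          simp only [← ENNReal.rpow_mul]
          rw [hconj.sub_one_mul_conj]
      _ = _ := by
          rw [lintegral_mul_const]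
          exact (Measurable.lintegral_prod_right' (hG.pow_const r)).pow_const _
  by_cases h0 : X = 0
  · rw [h0, ENNReal.zero_rpow_of_pos (by positivity)]; exact zero_le
  have hpos : X ^ (1 / r') ≠ 0 := by
    simp [ENNReal.rpow_eq_zero_iff, h0, hconj.symm.pos.le]
  have hnt : X ^ (1 / r') ≠ ⊤ := ENNReal.rpow_ne_top_of_nonneg (by
    have := hconj.symm.pos; positivity) hfin
  rw [← ENNReal.mul_le_mul_iff_left hpos hnt]
  refine le_trans (le_of_eq ?_) h1
  rw [← ENNReal.rpow_add _ _ h0 hfin]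
  have := hconj.inv_add_inv_eq_one
  rw [one_div, one_div, this, ENNReal.rpow_one]

/-- The Hausdorff–Young inequality for functions whose modulus is bounded and bounded below. -/
lemma lintegral_fourier_rpow_le_of_log_bounded {p q : ℝ} (hpq : p.HolderConjugate q) (hp2 : p ≤ 2)
    {φ : ℝ → ℂ} (hφm : Measurable φ) (hφ : Integrable φ) {B : ℝ}
    (hφB : ∀ x, |Real.log ‖φ x‖| ≤ B) :
    ∫⁻ ξ, ‖𝓕 φ ξ‖ₑ ^ q ≤ (∫⁻ x, ‖φ x‖ₑ ^ p) ^ (q / p) := by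
  have hp1 := hpq.lt
  have hp0 := hpq.pos
  have hq0 := hpq.symm.pos
  have hq1 := hpq.symm.lt
  have hc : Continuous (𝓕 φ) := continuous_fourier_of_integrable hφ
  set P := ∫ x, ‖φ x‖ ^ p with hP
  have hP0 : 0 ≤ P := integral_nonneg fun x => by positivity
  have hPe : ∫⁻ x, ‖φ x‖ₑ ^ p = ENNReal.ofReal P := by
    rw [hP, ofReal_integral_eq_lintegral_ofReal (integrable_norm_rpow hφm hφ hφB hp0)
      (Eventually.of_forall fun x => by positivity)]
    refine lintegral_congr fun x => ?_
    rw [← ofReal_norm, ENNReal.ofReal_rpow_of_nonneg (norm_nonneg _) hp0.le]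
  rw [hPe, ENNReal.ofReal_rpow_of_nonneg hP0 (by positivity)]
  let E : ℕ → Set ℝ := fun k => {ξ | 1 / ((k : ℝ) + 1) ≤ ‖𝓕 φ ξ‖} ∩ Icc (-(k : ℝ)) k
  have hEm : ∀ k, MeasurableSet (E k) := fun k =>
    (measurableSet_le measurable_const hc.norm.measurable).inter measurableSet_Icc
  refine lintegral_le_of_tendsto_of_forall_le
    (F := fun k => (E k).indicator fun ξ => ‖𝓕 φ ξ‖ₑ ^ q) ?_ ?_ ?_
  · exact fun k => ((hc.enorm.measurable.pow_const q).indicator (hEm k)).aemeasurable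
  · refine Eventually.of_forall fun ξ => ?_
    by_cases h : 𝓕 φ ξ = 0
    · have : ∀ k, (E k).indicator (fun ξ => ‖𝓕 φ ξ‖ₑ ^ q) ξ = ‖𝓕 φ ξ‖ₑ ^ q := by
        intro k
        by_cases hk : ξ ∈ E k
        · rw [indicator_of_mem hk]
        · rw [indicator_of_notMem hk, h]; simp [hq0]
      simp only [this]
      exact tendsto_const_nhds
    · refine tendsto_const_nhds.congr' ?_
      have h1 : ∀ᶠ k : ℕ in atTop, 1 / ((k : ℝ) + 1) ≤ ‖𝓕 φ ξ‖ :=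
        (tendsto_one_div_add_atTop_nhds_zero_nat (𝕜 := ℝ)).eventually_le_const (norm_pos_iff.2 h)
      filter_upwards [h1, eventually_ge_atTop ⌈|ξ|⌉₊] with k hk1 hk2
      rw [indicator_of_mem]
      exact ⟨hk1, abs_le.1 ((Nat.le_ceil _).trans (by exact_mod_cast hk2))⟩
  · intro k
    set L := ∫ x, ‖φ x‖ with hL
    have hbd : ∀ ξ, ‖𝓕 φ ξ‖ ≤ L := norm_fourier_le_integral_norm φ
    let ψ : ℝ → ℂ := (E k).indicator
      fun ξ => (starRingEnd ℂ) (𝓕 φ ξ) * ((‖𝓕 φ ξ‖ ^ (q - 2) : ℝ) : ℂ)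
    have hψm : Measurable ψ := by
      refine Measurable.indicator ?_ (hEm k)
      have := hc.measurable
      fun_prop
    have hpos : ∀ ξ ∈ E k, 0 < ‖𝓕 φ ξ‖ := fun ξ hξ => lt_of_lt_of_le (by positivity) hξ.1
    have hψn : ∀ ξ ∈ E k, ‖ψ ξ‖ = ‖𝓕 φ ξ‖ ^ (q - 1) := by
      intro ξ hξ
      simp only [ψ, indicator_of_mem hξ]
      rw [norm_mul, RCLike.norm_conj, Complex.norm_real, Real.norm_of_nonneg (by positivity),
        mul_comm, ← Real.rpow_add_one (hpos ξ hξ).ne']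
      congr 1; ring
    have hψ0 : ∀ ξ ∉ E k, ψ ξ = 0 := fun ξ hξ => indicator_of_notMem hξ _
    have hEfin : volume (E k) < ⊤ :=
      (measure_mono inter_subset_right).trans_lt measure_Icc_lt_top
    have hψi : Integrable ψ := by
      have : Integrable ((E k).indicator fun _ : ℝ => (L ^ (q - 1) : ℝ)) :=
        (integrable_indicator_iff (hEm k)).2 (integrableOn_const hEfin.ne)
      refine this.mono' hψm.aestronglyMeasurable (Eventually.of_forall fun ξ => ?_)
      by_cases hξ : ξ ∈ E k
      · rw [hψn ξ hξ, indicator_of_mem hξ]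
        exact Real.rpow_le_rpow (norm_nonneg _) (hbd ξ) (by linarith)
      · rw [hψ0 ξ hξ, indicator_of_notMem hξ, norm_zero]
    let B' : ℝ := (q - 1) * (|Real.log L| + |Real.log (1 / ((k : ℝ) + 1))|)
    have hB'0 : 0 ≤ B' := mul_nonneg (by linarith) (by positivity)
    have hψB : ∀ ξ, |Real.log ‖ψ ξ‖| ≤ B' := by
      intro ξ
      by_cases hξ : ξ ∈ E k
      · rw [hψn ξ hξ, Real.log_rpow (hpos ξ hξ), abs_mul, abs_of_nonneg (by linarith)]
        refine mul_le_mul_of_nonneg_left ?_ (by linarith)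
        have l1 : Real.log ‖𝓕 φ ξ‖ ≤ Real.log L := Real.log_le_log (hpos ξ hξ) (hbd ξ)
        have l2 : Real.log (1 / ((k : ℝ) + 1)) ≤ Real.log ‖𝓕 φ ξ‖ :=
          Real.log_le_log (by positivity) hξ.1
        rw [abs_le]
        constructor
        · linarith [neg_abs_le (Real.log (1 / ((k : ℝ) + 1))), abs_nonneg (Real.log L)]
        · linarith [le_abs_self (Real.log L), abs_nonneg (Real.log (1 / ((k : ℝ) + 1)))]
      · rw [hψ0 ξ hξ]; simpa using hB'0
    have main := norm_integral_mul_fourier_le hp1 hp2 hφm hψm hφ hψi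
      (B := max B B') (fun x => (hφB x).trans (le_max_left _ _))
      (fun x => (hψB x).trans (le_max_right _ _))
    set X := ∫ ξ, (E k).indicator (fun ξ => ‖𝓕 φ ξ‖ ^ q) ξ with hX
    have hX0 : 0 ≤ X := integral_nonneg fun ξ => indicator_nonneg (fun _ _ => by positivity) _
    have e1 : ∫ ξ, ψ ξ * 𝓕 φ ξ = (X : ℂ) := by
      rw [hX, ← integral_complex_ofReal]
      refine integral_congr_ae (Eventually.of_forall fun ξ => ?_)
      by_cases hξ : ξ ∈ E k
      · simp only [ψ, indicator_of_mem hξ]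
        rw [mul_right_comm, ← Complex.normSq_eq_conj_mul_self, Complex.normSq_eq_norm_sq,
          ← Complex.ofReal_mul, ← Real.rpow_two, ← Real.rpow_add (hpos ξ hξ)]
        congr 2; ring
      · simp only [hψ0 ξ hξ, indicator_of_notMem hξ, zero_mul, Complex.ofReal_zero]
    have e2 : ∫ ξ, ‖ψ ξ‖ ^ p = X := by
      rw [hX]
      refine integral_congr_ae (Eventually.of_forall fun ξ => ?_)
      by_cases hξ : ξ ∈ E k
      · simp only [indicator_of_mem hξ, hψn ξ hξ]
        rw [← Real.rpow_mul (norm_nonneg _), hpq.symm.sub_one_mul_conj]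
      · simp only [hψ0 ξ hξ, indicator_of_notMem hξ, norm_zero, Real.zero_rpow hp0.ne']
    rw [e1, e2, Complex.norm_real, Real.norm_of_nonneg hX0, ← hP] at main
    have hXi : Integrable ((E k).indicator (fun ξ => ‖𝓕 φ ξ‖ ^ q)) := by
      refine (integrable_norm_rpow hψm hψi hψB hp0).congr (Eventually.of_forall fun ξ => ?_)
      by_cases hξ : ξ ∈ E k
      · simp only [indicator_of_mem hξ, hψn ξ hξ]
        rw [← Real.rpow_mul (norm_nonneg _), hpq.symm.sub_one_mul_conj]
      · simp only [hψ0 ξ hξ, indicator_of_notMem hξ, norm_zero, Real.zero_rpow hp0.ne']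
    have hXle : X ≤ P ^ (q / p) := by
      rcases hX0.eq_or_lt with h0 | hXpos
      · rw [← h0]; positivity
      · rw [Real.mul_rpow hP0 hX0] at main
        have h3 : X ^ (1 / q) ≤ P ^ (1 / p) := by
          have h4 : X = X ^ (1 / q) * X ^ (1 / p) := by
            rw [← Real.rpow_add hXpos, one_div, one_div, add_comm, hpq.inv_add_inv_eq_one,
              Real.rpow_one]
          refine le_of_mul_le_mul_right ?_ (Real.rpow_pos_of_pos hXpos (1 / p))
          rw [← h4]
          exact main
        have h5 := Real.rpow_le_rpow (by positivity) h3 hq0.le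
        rw [← Real.rpow_mul hX0, ← Real.rpow_mul hP0, one_div_mul_cancel hq0.ne',
          Real.rpow_one] at h5
        refine h5.trans_eq ?_
        congr 1; ring
    refine le_trans (le_of_eq ?_) (ENNReal.ofReal_le_ofReal hXle)
    rw [hX, ofReal_integral_eq_lintegral_ofReal hXi
      (Eventually.of_forall fun ξ => indicator_nonneg (fun _ _ => by positivity) _)]
    refine lintegral_congr fun ξ => ?_
    by_cases hξ : ξ ∈ E k
    · simp only [indicator_of_mem hξ]
      rw [← ofReal_norm, ENNReal.ofReal_rpow_of_nonneg (norm_nonneg _) hq0.le]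
    · simp only [indicator_of_notMem hξ, ENNReal.ofReal_zero]

/-- The Hausdorff–Young inequality on the real line. -/
lemma lintegral_fourier_rpow_le {p q : ℝ} (hpq : p.HolderConjugate q) (hp2 : p ≤ 2)
    {φ : ℝ → ℂ} (hφm : Measurable φ) (hφ : Integrable φ) :
    ∫⁻ ξ, ‖𝓕 φ ξ‖ₑ ^ q ≤ (∫⁻ x, ‖φ x‖ₑ ^ p) ^ (q / p) := by
  have hp0 := hpq.pos
  have hq0 := hpq.symm.pos
  let E : ℕ → Set ℝ := fun k => {x | 1 / ((k : ℝ) + 1) ≤ ‖φ x‖ ∧ ‖φ x‖ ≤ k}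
  have hEm : ∀ k, MeasurableSet (E k) := fun k =>
    (measurableSet_le measurable_const hφm.norm).inter
      (measurableSet_le hφm.norm measurable_const)
  let χ : ℕ → ℝ → ℂ := fun k => (E k).indicator φ
  have hχm : ∀ k, Measurable (χ k) := fun k => hφm.indicator (hEm k)
  have hχ : ∀ k, Integrable (χ k) := fun k => hφ.indicator (hEm k)
  have hχlim : ∀ x, Tendsto (fun k => χ k x) atTop (𝓝 (φ x)) := by
    intro x
    by_cases h : φ x = 0
    · have : ∀ k, χ k x = φ x := fun k => by
        by_cases hk : x ∈ E k
        · simp only [χ, indicator_of_mem hk]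
        · simp only [χ, indicator_of_notMem hk, h]
      simp only [this]
      exact tendsto_const_nhds
    · refine tendsto_const_nhds.congr' ?_
      have h1 : ∀ᶠ k : ℕ in atTop, 1 / ((k : ℝ) + 1) ≤ ‖φ x‖ :=
        (tendsto_one_div_add_atTop_nhds_zero_nat (𝕜 := ℝ)).eventually_le_const (norm_pos_iff.2 h)
      filter_upwards [h1, eventually_ge_atTop ⌈‖φ x‖⌉₊] with k hk1 hk2
      have : x ∈ E k := ⟨hk1, (Nat.le_ceil _).trans (by exact_mod_cast hk2)⟩
      simp only [χ, indicator_of_mem this]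
  refine lintegral_le_of_tendsto_of_forall_le (F := fun k ξ => ‖𝓕 (χ k) ξ‖ₑ ^ q) ?_ ?_ ?_
  · exact fun k => ((continuous_fourier_of_integrable (hχ k)).enorm.measurable.pow_const
      q).aemeasurable
  · refine Eventually.of_forall fun ξ => ?_
    have : Tendsto (fun k => 𝓕 (χ k) ξ) atTop (𝓝 (𝓕 φ ξ)) := by
      simp only [Real.fourier_real_eq]
      refine tendsto_integral_of_dominated_convergence (fun x => ‖φ x‖) ?_ hφ.norm ?_ ?_
      · intro k
        have := hχm k
        refine AEStronglyMeasurable.fun_smul (Continuous.aestronglyMeasurable ?_)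
          (hχm k).aestronglyMeasurable
        fun_prop
      · intro k
        refine Eventually.of_forall fun x => ?_
        rw [Circle.norm_smul]
        exact norm_indicator_le_norm_self _ _
      · exact Eventually.of_forall fun x => (hχlim x).const_smul _
    exact this.enorm.ennrpow_const q
  · intro k
    have hB : ∀ x, |Real.log ‖χ k x‖| ≤ |Real.log (1 / ((k : ℝ) + 1))| + |Real.log k| := by
      intro x
      by_cases hx : x ∈ E k
      · simp only [χ, indicator_of_mem hx]
        have hpos : 0 < ‖φ x‖ := lt_of_lt_of_le (by positivity) hx.1
        have l1 : Real.log ‖φ x‖ ≤ Real.log k := Real.log_le_log hpos hx.2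
        have l2 : Real.log (1 / ((k : ℝ) + 1)) ≤ Real.log ‖φ x‖ :=
          Real.log_le_log (by positivity) hx.1
        rw [abs_le]
        constructor
        · linarith [neg_abs_le (Real.log (1 / ((k : ℝ) + 1))), abs_nonneg (Real.log k)]
        · linarith [le_abs_self (Real.log k), abs_nonneg (Real.log (1 / ((k : ℝ) + 1)))]
      · simp only [χ, indicator_of_notMem hx, norm_zero, Real.log_zero, abs_zero]
        positivity
    refine (lintegral_fourier_rpow_le_of_log_bounded hpq hp2 (hχm k) (hχ k) hB).trans ?_
    refine ENNReal.rpow_le_rpow (lintegral_mono fun x => ?_) (by positivity)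
    refine ENNReal.rpow_le_rpow ?_ hp0.le
    exact enorm_indicator_le_enorm_self _ _

/-- Holomorphic functions on the right half-plane with quadratic decay along vertical lines,
uniformly on every smaller half-plane. -/
structure DecaysOnHalfPlanes (F : ℂ → ℂ) : Prop where
  diff : DifferentiableOn ℂ F {z : ℂ | 0 < z.re}
  decay : ∀ δ : ℝ, 0 < δ → ∃ C : ℝ, ∀ z : ℂ, δ ≤ z.re → ‖F z‖ ≤ C * (1 + z.im ^ 2)⁻¹

lemma continuous_verticalLine {F : ℂ → ℂ} (hF : DifferentiableOn ℂ F {z : ℂ | 0 < z.re}) {u : ℝ}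
    (hu : 0 < u) : Continuous fun v : ℝ => F ((u : ℂ) + (v : ℂ) * Complex.I) :=
  hF.continuousOn.comp_continuous (by fun_prop) fun v => by simpa using hu

/-- A holomorphic function with quadratic decay has the same integral along parallel vertical
lines. -/
lemma integral_verticalLine_eq {H : ℂ → ℂ} (hH : DifferentiableOn ℂ H {z : ℂ | 0 < z.re})
    {a b C : ℝ} (ha : 0 < a) (hab : a ≤ b)
    (hC : ∀ z : ℂ, a ≤ z.re → z.re ≤ b → ‖H z‖ ≤ C * (1 + z.im ^ 2)⁻¹) :
    ∫ v : ℝ, H ((a : ℂ) + (v : ℂ) * Complex.I) = ∫ v : ℝ, H ((b : ℂ) + (v : ℂ) * Complex.I) := by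
  have hint : ∀ u : ℝ, a ≤ u → u ≤ b → Integrable fun v : ℝ => H ((u : ℂ) + (v : ℂ) * Complex.I) := by
    intro u hau hub
    refine (integrable_inv_one_add_sq.const_mul C).mono'
      (continuous_verticalLine hH (ha.trans_le hau)).aestronglyMeasurable
      (Eventually.of_forall fun v => ?_)
    simpa using hC ((u : ℂ) + (v : ℂ) * Complex.I) (by simpa using hau) (by simpa using hub)
  have hlim : ∀ u : ℝ, a ≤ u → u ≤ b → Tendsto
      (fun T : ℝ => ∫ y in (-T)..T, H ((u : ℂ) + (y : ℂ) * Complex.I)) atTop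
      (𝓝 (∫ v : ℝ, H ((u : ℂ) + (v : ℂ) * Complex.I))) := fun u hau hub =>
    intervalIntegral_tendsto_integral (hint u hau hub) tendsto_neg_atTop_atBot tendsto_id
  have hdecay : Tendsto (fun T : ℝ => C * (1 + T ^ 2)⁻¹ * |b - a|) atTop (𝓝 0) := by
    have : Tendsto (fun T : ℝ => (1 + T ^ 2)⁻¹) atTop (𝓝 0) :=
      tendsto_inv_atTop_zero.comp (tendsto_atTop_add_const_left _ _ (tendsto_pow_atTop two_ne_zero))
    simpa using (this.const_mul C).mul_const |b - a|
  have hhor : ∀ s : ℝ, s ^ 2 = 1 →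
      Tendsto (fun T : ℝ => ∫ x in a..b, H ((x : ℂ) + ((s * T : ℝ) : ℂ) * Complex.I)) atTop
        (𝓝 0) := by
    intro s hs
    refine squeeze_zero_norm (fun T => ?_) hdecay
    refine intervalIntegral.norm_integral_le_of_norm_le_const fun x hx => ?_
    rw [uIoc_of_le hab] at hx
    have := hC ((x : ℂ) + ((s * T : ℝ) : ℂ) * Complex.I) (by simpa using hx.1.le)
      (by simpa using hx.2)
    have him : ((x : ℂ) + ((s * T : ℝ) : ℂ) * Complex.I).im = s * T := by simp
    rwa [him, mul_pow, hs, one_mul] at this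
  have hrect : ∀ T : ℝ,
      (∫ x in a..b, H ((x : ℂ) + (((-1) * T : ℝ) : ℂ) * Complex.I))
      - (∫ x in a..b, H ((x : ℂ) + ((1 * T : ℝ) : ℂ) * Complex.I))
      + Complex.I • (∫ y in (-T)..T, H ((b : ℂ) + (y : ℂ) * Complex.I))
      - Complex.I • (∫ y in (-T)..T, H ((a : ℂ) + (y : ℂ) * Complex.I)) = 0 := by
    intro T
    have := Complex.integral_boundary_rect_eq_zero_of_differentiableOn H
      ⟨a, -T⟩ ⟨b, T⟩ (hH.mono ?_)
    · simpa using this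
    · intro z hz
      have := hz.1
      rw [mem_preimage, uIcc_of_le hab] at this
      exact ha.trans_le this.1
  have hfin := (((hhor (-1) (by norm_num)).sub (hhor 1 (by norm_num))).add
    ((hlim b hab le_rfl).const_smul Complex.I)).sub ((hlim a le_rfl hab).const_smul Complex.I)
  have h0 := tendsto_nhds_unique hfin (tendsto_const_nhds.congr fun T => (hrect T).symm)
  rw [sub_zero, zero_add, sub_eq_zero] at h0
  simpa using h0.symm

/-- The integral of `F(z) e ^ (-z w)` along the line `Re z = u`. -/
noncomputable def lineTransform (F : ℂ → ℂ) (u w : ℝ) : ℂ :=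
  ∫ v : ℝ, F ((u : ℂ) + (v : ℂ) * Complex.I) *
    Complex.exp (-((u : ℂ) + (v : ℂ) * Complex.I) * w)

namespace DecaysOnHalfPlanes

variable {F : ℂ → ℂ}

lemma sub {G : ℂ → ℂ} (hF : DecaysOnHalfPlanes F) (hG : DecaysOnHalfPlanes G) :
    DecaysOnHalfPlanes (F - G) where
  diff := hF.diff.sub hG.diff
  decay δ hδ := by
    obtain ⟨C, hC⟩ := hF.decay δ hδ
    obtain ⟨D, hD⟩ := hG.decay δ hδ
    refine ⟨C + D, fun z hz => ?_⟩
    rw [add_mul]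
    exact (norm_sub_le _ _).trans (add_le_add (hC z hz) (hD z hz))

lemma integrable_line (hF : DecaysOnHalfPlanes F) {u : ℝ} (hu : 0 < u) :
    Integrable fun v : ℝ => F ((u : ℂ) + (v : ℂ) * Complex.I) := by
  obtain ⟨C, hC⟩ := hF.decay u hu
  refine (integrable_inv_one_add_sq.const_mul C).mono'
    (continuous_verticalLine hF.diff hu).aestronglyMeasurable (Eventually.of_forall fun v => ?_)
  simpa using hC ((u : ℂ) + (v : ℂ) * Complex.I) (by simp)

lemma lineTransform_eq_fourier (F : ℂ → ℂ) (u w : ℝ) :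
    lineTransform F u w = Complex.exp (-(u * w : ℝ)) *
      𝓕 (fun v : ℝ => F ((u : ℂ) + (v : ℂ) * Complex.I)) (w / (2 * π)) := by
  rw [Real.fourier_real_eq_integral_exp_smul, ← integral_const_mul]
  refine integral_congr_ae (Eventually.of_forall fun v => ?_)
  have h : -2 * π * v * (w / (2 * π)) = -(v * w) := by
    have := Real.pi_ne_zero
    field_simp
  simp only [smul_eq_mul]
  rw [h, ← mul_assoc, ← Complex.exp_add, mul_comm]
  congr 2
  push_cast
  ring

lemma lineTransform_eq_of_le (hF : DecaysOnHalfPlanes F) {a b : ℝ} (ha : 0 < a) (hab : a ≤ b)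
    (w : ℝ) : lineTransform F a w = lineTransform F b w := by
  obtain ⟨C, hC⟩ := hF.decay a ha
  refine integral_verticalLine_eq (H := fun z => F z * Complex.exp (-z * w))
    (C := C * Real.exp (b * |w|)) (hF.diff.mul (by fun_prop)) ha hab fun z hz1 hz2 => ?_
  rw [norm_mul, Complex.norm_exp, Complex.re_mul_ofReal, Complex.neg_re]
  have h1 : Real.exp (-z.re * w) ≤ Real.exp (b * |w|) := by
    apply Real.exp_le_exp.2
    have : -z.re * w ≤ |z.re * w| := by rw [neg_mul]; exact neg_le_abs _
    rw [abs_mul, abs_of_nonneg (ha.le.trans hz1)] at this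
    exact this.trans (by gcongr)
  calc ‖F z‖ * Real.exp (-z.re * w) ≤ (C * (1 + z.im ^ 2)⁻¹) * Real.exp (b * |w|) := by
        have := hC z hz1
        gcongr
        exact (norm_nonneg _).trans this
    _ = _ := by ring

lemma lineTransform_eq (hF : DecaysOnHalfPlanes F) {a b : ℝ} (ha : 0 < a) (hb : 0 < b)
    (w : ℝ) : lineTransform F a w = lineTransform F b w := by
  rcases le_total a b with h | h
  · exact hF.lineTransform_eq_of_le ha h w
  · exact (hF.lineTransform_eq_of_le hb h w).symm

lemma norm_lineTransform_le (u w : ℝ) : ‖lineTransform F u w‖ ≤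
    Real.exp (-(u * w)) * ∫ v : ℝ, ‖F ((u : ℂ) + (v : ℂ) * Complex.I)‖ := by
  rw [lineTransform_eq_fourier, norm_mul, ← Complex.ofReal_neg, ← Complex.ofReal_exp,
    Complex.norm_real, Real.norm_of_nonneg (Real.exp_pos _).le]
  gcongr
  exact norm_fourier_le_integral_norm _ _

lemma lineTransform_eq_zero (hF : DecaysOnHalfPlanes F) {u w : ℝ} (hu : 0 < u) (hw : 0 < w) :
    lineTransform F u w = 0 := by
  obtain ⟨C, hC⟩ := hF.decay 1 one_pos
  have hle : ∀ᶠ s : ℝ in atTop, ‖lineTransform F u w‖ ≤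
      Real.exp (-(s * w)) * ∫ v : ℝ, C * (1 + v ^ 2)⁻¹ := by
    filter_upwards [eventually_ge_atTop 1] with s hs
    rw [hF.lineTransform_eq hu (one_pos.trans_le hs)]
    refine (norm_lineTransform_le s w).trans ?_
    gcongr
    · exact (hF.integrable_line (one_pos.trans_le hs)).norm
    · exact integrable_inv_one_add_sq.const_mul C
    · intro v
      simpa using hC ((s : ℂ) + (v : ℂ) * Complex.I) (by simpa using hs)
  have hlim : Tendsto (fun s : ℝ => Real.exp (-(s * w)) * ∫ v : ℝ, C * (1 + v ^ 2)⁻¹) atTop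
      (𝓝 0) := by
    have : Tendsto (fun s : ℝ => Real.exp (-(s * w))) atTop (𝓝 0) :=
      Real.tendsto_exp_neg_atTop_nhds_zero.comp (tendsto_id.atTop_mul_const hw)
    simpa using this.mul_const (∫ v : ℝ, C * (1 + v ^ 2)⁻¹)
  exact norm_le_zero_iff.1 (ge_of_tendsto hlim hle)

lemma fourier_line_eq (hF : DecaysOnHalfPlanes F) {u : ℝ} (hu : 0 < u) (ξ : ℝ) :
    𝓕 (fun v : ℝ => F ((u : ℂ) + (v : ℂ) * Complex.I)) ξ =
      Complex.exp ((u * (2 * π * ξ) : ℝ)) * lineTransform F 1 (2 * π * ξ) := by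
  rw [hF.lineTransform_eq one_pos hu, lineTransform_eq_fourier, ← mul_assoc, ← Complex.exp_add]
  have h : 2 * π * ξ / (2 * π) = ξ := by
    have := Real.pi_ne_zero
    field_simp
  rw [h]
  simp

lemma continuous_lineTransform (hF : DecaysOnHalfPlanes F) :
    Continuous (lineTransform F 1) := by
  have h := continuous_fourier_of_integrable (hF.integrable_line one_pos)
  have : lineTransform F 1 = fun w => Complex.exp (-((1 : ℝ) * w : ℝ)) *
      𝓕 (fun v : ℝ => F (((1 : ℝ) : ℂ) + (v : ℂ) * Complex.I)) (w / (2 * π)) := by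
    ext w; exact lineTransform_eq_fourier F 1 w
  rw [this]
  exact (by fun_prop : Continuous fun w : ℝ => Complex.exp (-((1 : ℝ) * w : ℝ))).mul
    (h.comp (by fun_prop))

lemma integrable_fourier_line (hF : DecaysOnHalfPlanes F) {u : ℝ} (hu : 0 < u) :
    Integrable (𝓕 (fun v : ℝ => F ((u : ℂ) + (v : ℂ) * Complex.I))) := by
  have hc := continuous_fourier_of_integrable (hF.integrable_line hu)
  set D := ∫ v : ℝ, ‖F (((u / 2 : ℝ) : ℂ) + (v : ℂ) * Complex.I)‖
  have hdom : Integrable ((Iic (0 : ℝ)).indicator fun ξ => Real.exp ((u * π) * ξ) * D) :=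
    (integrable_indicator_iff measurableSet_Iic).2
      ((integrableOn_exp_mul_Iic (by positivity) 0).mul_const D)
  refine hdom.mono' hc.aestronglyMeasurable (Eventually.of_forall fun ξ => ?_)
  rw [hF.fourier_line_eq hu]
  by_cases hξ : ξ ∈ Iic (0 : ℝ)
  · rw [indicator_of_mem hξ, norm_mul, ← Complex.ofReal_exp, Complex.norm_real,
      Real.norm_of_nonneg (Real.exp_pos _).le, hF.lineTransform_eq one_pos (half_pos hu)]
    calc Real.exp (u * (2 * π * ξ)) * ‖lineTransform F (u / 2) (2 * π * ξ)‖
        ≤ Real.exp (u * (2 * π * ξ)) * (Real.exp (-(u / 2 * (2 * π * ξ))) * D) := by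
          gcongr
          exact norm_lineTransform_le _ _
      _ = _ := by
          rw [← mul_assoc, ← Real.exp_add]
          congr 2; ring
  · rw [indicator_of_notMem hξ]
    have : 0 < 2 * π * ξ := by
      have : 0 < ξ := not_le.1 hξ
      positivity
    rw [hF.lineTransform_eq_zero one_pos this]
    simp

/-- Laplace representation of a function with quadratic decay along vertical lines. -/
lemma eq_integral_lineTransform (hF : DecaysOnHalfPlanes F) {z : ℂ} (hz : 0 < z.re) :
    F z = (2 * π : ℂ)⁻¹ * ∫ w in Iio (0 : ℝ), Complex.exp (z * w) * lineTransform F 1 w := by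
  have hc := continuous_verticalLine hF.diff hz
  have hinv := congrFun (hc.fourierInv_fourier_eq (hF.integrable_line hz)
    (hF.integrable_fourier_line hz)) z.im
  rw [Complex.re_add_im] at hinv
  rw [← hinv, Real.fourierInv_eq']
  let K : ℝ → ℂ := fun w => Complex.exp (z * w) * lineTransform F 1 w
  have e1 : ∀ ξ : ℝ, Complex.exp (↑(2 * π * inner ℝ ξ z.im) * Complex.I) •
      𝓕 (fun v : ℝ => F ((z.re : ℂ) + (v : ℂ) * Complex.I)) ξ = K (2 * π * ξ) := by
    intro ξ
    rw [hF.fourier_line_eq hz, smul_eq_mul, ← mul_assoc, ← Complex.exp_add]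
    simp only [K]
    congr 2
    have hz' := Complex.re_add_im z
    have hi : inner ℝ ξ z.im = z.im * ξ := rfl
    rw [hi]
    push_cast
    linear_combination (2 * π * ξ : ℂ) * hz'
  simp only [e1]
  rw [Measure.integral_comp_mul_left K (2 * π), abs_of_pos (by positivity)]
  have e2 : ∫ w, K w = ∫ w in Iio (0 : ℝ), K w := by
    rw [← integral_Iic_eq_integral_Iio]
    refine (setIntegral_eq_integral_of_forall_compl_eq_zero fun w hw => ?_).symm
    simp only [K]
    rw [hF.lineTransform_eq_zero one_pos (not_le.1 hw), mul_zero]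
  rw [e2, Complex.real_smul]
  push_cast
  rfl

end DecaysOnHalfPlanes

/-- The density `g` for which `F(z) = (2π)^(-1/2) ∫_{w < 0} e^(z w) g(w) dw`. -/
noncomputable def spectralDensity (F : ℂ → ℂ) (w : ℝ) : ℂ :=
  (Real.sqrt (2 * π) : ℂ)⁻¹ * lineTransform F 1 w

namespace DecaysOnHalfPlanes

variable {F : ℂ → ℂ} {p q : ℝ}

lemma continuous_spectralDensity (hF : DecaysOnHalfPlanes F) :
    Continuous (spectralDensity F) :=
  continuous_const.mul hF.continuous_lineTransform

lemma spectralDensity_sub {G : ℂ → ℂ} (hF : DecaysOnHalfPlanes F) (hG : DecaysOnHalfPlanes G)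
    (w : ℝ) : spectralDensity (F - G) w = spectralDensity F w - spectralDensity G w := by
  have h : ∀ {H : ℂ → ℂ}, DecaysOnHalfPlanes H → Integrable fun v : ℝ =>
      H (((1 : ℝ) : ℂ) + (v : ℂ) * Complex.I) *
        Complex.exp (-(((1 : ℝ) : ℂ) + (v : ℂ) * Complex.I) * w) := fun {H} hH =>
    (hH.integrable_line one_pos).mul_bdd (c := Real.exp (-w))
      (Continuous.aestronglyMeasurable (by fun_prop)) (Eventually.of_forall fun v => by
        rw [Complex.norm_exp]; simp)
  simp only [spectralDensity, lineTransform, Pi.sub_apply, sub_mul]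
  rw [integral_sub (h hF) (h hG), mul_sub]

lemma eq_integral_spectralDensity (hF : DecaysOnHalfPlanes F) {z : ℂ} (hz : 0 < z.re) :
    F z = (Real.sqrt (2 * π) : ℂ)⁻¹ *
      ∫ w in Iio (0 : ℝ), Complex.exp (z * w) * spectralDensity F w := by
  have h2 : (2 * π : ℂ) = (Real.sqrt (2 * π) : ℂ) * (Real.sqrt (2 * π) : ℂ) := by
    rw [← Complex.ofReal_mul, Real.mul_self_sqrt (by positivity)]
    push_cast; rfl
  rw [hF.eq_integral_lineTransform hz, h2, mul_inv, mul_assoc, ← integral_const_mul]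
  congr 2
  ext w
  simp only [spectralDensity]
  ring

/-- Hausdorff–Young on a vertical line. -/
lemma lintegral_exp_mul_spectralDensity_le (hF : DecaysOnHalfPlanes F)
    (hpq : p.HolderConjugate q) (hp2 : p ≤ 2) {u : ℝ} (hu : 0 < u) :
    ∫⁻ w : ℝ, ‖Complex.exp ((u * w : ℝ)) * spectralDensity F w‖ₑ ^ q ≤
      (∫⁻ v : ℝ, ‖F ((u : ℂ) + (v : ℂ) * Complex.I)‖ₑ ^ p) ^ (q / p) := by
  have hq0 : 0 < q := hpq.symm.pos
  have hq2 : 2 ≤ q := by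
    have h1 := hpq.inv_add_inv_eq_one
    have h2 : (2 : ℝ)⁻¹ ≤ p⁻¹ := inv_anti₀ hpq.pos hp2
    have h3 : q⁻¹ ≤ (2 : ℝ)⁻¹ := by linarith
    exact (inv_le_inv₀ hq0 two_pos).1 h3
  have hpi : (0 : ℝ) < 2 * π := by positivity
  have hpi1 : (1 : ℝ) ≤ 2 * π := by linarith [Real.pi_gt_three]
  set s : ℝ≥0∞ := ENNReal.ofReal (2 * π)
  have hs0 : s ≠ 0 := by simpa [s] using hpi
  have hst : s ≠ ⊤ := ENNReal.ofReal_ne_top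
  have hs1 : 1 ≤ s := ENNReal.one_le_ofReal.2 hpi1
  have hconst : ‖(Real.sqrt (2 * π) : ℂ)⁻¹‖ₑ ^ q = s ^ (-(q / 2)) := by
    have h1 : ‖(Real.sqrt (2 * π) : ℂ)‖ₑ = s ^ (1 / 2 : ℝ) := by
      rw [← ofReal_norm, Complex.norm_real, Real.norm_of_nonneg (Real.sqrt_nonneg _),
        Real.sqrt_eq_rpow, ENNReal.ofReal_rpow_of_pos hpi]
    rw [enorm_inv (by simpa using (Real.sqrt_pos.2 hpi).ne'), h1, ← ENNReal.rpow_neg, ← ENNReal.rpow_mul]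
    congr 1; ring
  have hmeas : Measurable fun w : ℝ => ‖Complex.exp ((u * w : ℝ)) * spectralDensity F w‖ₑ ^ q :=
    ((Continuous.mul (by fun_prop) hF.continuous_spectralDensity).measurable.enorm).pow_const q
  have hscale : ∫⁻ w : ℝ, ‖Complex.exp ((u * w : ℝ)) * spectralDensity F w‖ₑ ^ q =
      s * ∫⁻ ξ : ℝ, ‖Complex.exp ((u * (2 * π * ξ) : ℝ)) * spectralDensity F (2 * π * ξ)‖ₑ ^ q := by
    conv_lhs => rw [← Real.smul_map_volume_mul_left hpi.ne']
    rw [lintegral_smul_measure, lintegral_map hmeas (by fun_prop), abs_of_pos hpi]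
    rfl
  have hpt : ∀ ξ : ℝ,
      ‖Complex.exp ((u * (2 * π * ξ) : ℝ)) * spectralDensity F (2 * π * ξ)‖ₑ ^ q =
        s ^ (-(q / 2)) * ‖𝓕 (fun v : ℝ => F ((u : ℂ) + (v : ℂ) * Complex.I)) ξ‖ₑ ^ q := by
    intro ξ
    rw [hF.fourier_line_eq hu, spectralDensity, mul_left_comm, enorm_mul,
      ENNReal.mul_rpow_of_nonneg _ _ hq0.le, hconst]
  have hfac : s * s ^ (-(q / 2)) ≤ 1 := by
    calc s * s ^ (-(q / 2)) = s ^ (1 + -(q / 2)) := by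
          rw [ENNReal.rpow_add _ _ hs0 hst, ENNReal.rpow_one]
      _ ≤ s ^ (0 : ℝ) := ENNReal.rpow_le_rpow_of_exponent_le hs1 (by linarith)
      _ = 1 := ENNReal.rpow_zero
  rw [hscale]
  simp only [hpt]
  rw [lintegral_const_mul' _ _ (ENNReal.rpow_ne_top_of_ne_zero hs0 hst), ← mul_assoc]
  calc _ ≤ 1 * ∫⁻ ξ, ‖𝓕 (fun v : ℝ => F ((u : ℂ) + (v : ℂ) * Complex.I)) ξ‖ₑ ^ q := by gcongr
    _ ≤ _ := by
      rw [one_mul]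
      exact lintegral_fourier_rpow_le hpq hp2 (continuous_verticalLine hF.diff hu).measurable
        (hF.integrable_line hu)

end DecaysOnHalfPlanes

lemma lintegral_Ioi_exp_mul {a : ℝ} (ha : a < 0) :
    ∫⁻ u in Ioi (0 : ℝ), ENNReal.ofReal (Real.exp (a * u)) = ENNReal.ofReal (1 / (-a)) := by
  rw [← ofReal_integral_eq_lintegral_ofReal (integrableOn_exp_mul_Ioi ha 0)
    (Eventually.of_forall fun u => (Real.exp_pos _).le), integral_exp_mul_Ioi ha 0]
  congr 1
  simp [neg_div, div_neg]

namespace DecaysOnHalfPlanes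

variable {F : ℂ → ℂ} {p q : ℝ}

lemma lintegral_spectralDensity_le_of_compact (hF : DecaysOnHalfPlanes F)
    (hpq : p.HolderConjugate q) (hp2 : p ≤ 2) {E : Set ℝ} (hE : IsCompact E)
    (hE0 : E ⊆ Iio 0) :
    ∫⁻ w in E, ENNReal.ofReal ((1 / (-(p * w))) ^ (q / p)) * ‖spectralDensity F w‖ₑ ^ q ≤
      (∫⁻ u in Ioi (0 : ℝ), ∫⁻ v : ℝ, ‖F ((u : ℂ) + (v : ℂ) * Complex.I)‖ₑ ^ p) ^ (q / p) := by
  have hp0 : 0 < p := hpq.pos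
  have hq0 : 0 < q := hpq.symm.pos
  have hpq' : p ≤ q := by
    have h1 := hpq.inv_add_inv_eq_one
    have h2 : (2 : ℝ)⁻¹ ≤ p⁻¹ := inv_anti₀ hpq.pos hp2
    exact (inv_le_inv₀ hq0 hp0).1 (by linarith)
  have hr : 1 ≤ q / p := (one_le_div hp0).2 hpq'
  have hr0 : 0 < q / p := by positivity
  have hg := hF.continuous_spectralDensity
  let G : ℝ → ℝ → ℝ≥0∞ := fun u w => ‖Complex.exp ((u * w : ℝ)) * spectralDensity F w‖ₑ ^ p
  have hG : Measurable (Function.uncurry G) := by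
    have : Continuous fun x : ℝ × ℝ => Complex.exp ((x.1 * x.2 : ℝ)) * spectralDensity F x.2 :=
      Continuous.mul (by fun_prop) (hg.comp continuous_snd)
    exact this.measurable.enorm.pow_const p
  have hGr : ∀ u w, G u w ^ (q / p) =
      ‖Complex.exp ((u * w : ℝ)) * spectralDensity F w‖ₑ ^ q := fun u w => by
    simp only [G]
    rw [← ENNReal.rpow_mul, mul_div_cancel₀ _ hp0.ne']
  have hint : ∀ w ∈ E, (∫⁻ u in Ioi (0 : ℝ), G u w) ^ (q / p) =
      ENNReal.ofReal ((1 / (-(p * w))) ^ (q / p)) * ‖spectralDensity F w‖ₑ ^ q := by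
    intro w hw
    have hw0 : w < 0 := hE0 hw
    have hpw : p * w < 0 := mul_neg_of_pos_of_neg hp0 hw0
    have h1 : ∀ u, G u w = ENNReal.ofReal (Real.exp (p * w * u)) * ‖spectralDensity F w‖ₑ ^ p := by
      intro u
      simp only [G]
      rw [enorm_mul, ENNReal.mul_rpow_of_nonneg _ _ hp0.le, ← Complex.ofReal_exp, ← ofReal_norm,
        Complex.norm_real, Real.norm_of_nonneg (Real.exp_pos _).le,
        ENNReal.ofReal_rpow_of_pos (Real.exp_pos _), ← Real.exp_mul]
      congr 3; ring
    simp only [h1]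
    rw [lintegral_mul_const' _ _ (ENNReal.rpow_ne_top_of_nonneg hp0.le enorm_ne_top),
      lintegral_Ioi_exp_mul hpw, ENNReal.mul_rpow_of_nonneg _ _ hr0.le, ← ENNReal.rpow_mul,
      mul_div_cancel₀ _ hp0.ne', ENNReal.ofReal_rpow_of_pos (by
        rw [one_div]; exact inv_pos.2 (neg_pos.2 hpw))]
  have heq : ∫⁻ w in E, ENNReal.ofReal ((1 / (-(p * w))) ^ (q / p)) * ‖spectralDensity F w‖ₑ ^ q =
      ∫⁻ w in E, (∫⁻ u in Ioi (0 : ℝ), G u w) ^ (q / p) :=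
    (setLIntegral_congr_fun hE.measurableSet hint).symm
  have hfin : ∫⁻ w in E, (∫⁻ u in Ioi (0 : ℝ), G u w) ^ (q / p) ≠ ⊤ := by
    rw [← heq]
    have hc : ContinuousOn (fun w : ℝ => (1 / (-(p * w))) ^ (q / p) * ‖spectralDensity F w‖ ^ q)
        E := by
      refine ContinuousOn.mul (ContinuousOn.rpow_const (ContinuousOn.div continuousOn_const
        (by fun_prop) fun w hw => ?_) fun w hw => Or.inr hr0.le)
        (hg.norm.rpow_const fun _ => Or.inr hq0.le).continuousOn
      exact (neg_pos.2 (mul_neg_of_pos_of_neg hp0 (hE0 hw))).ne'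
    have := (hc.integrableOn_compact (μ := volume) hE).lintegral_lt_top
    refine ne_top_of_le_ne_top this.ne (le_of_eq (setLIntegral_congr_fun hE.measurableSet ?_))
    intro w hw
    simp only
    rw [ENNReal.ofReal_mul, ← ofReal_norm, ENNReal.ofReal_rpow_of_nonneg (norm_nonneg _) hq0.le]
    have : 0 ≤ 1 / (-(p * w)) := by
      rw [one_div]
      exact (inv_pos.2 (neg_pos.2 (mul_neg_of_pos_of_neg hp0 (hE0 hw)))).le
    positivity
  have hmink := lintegral_rpow_lintegral_le (μ := volume.restrict (Ioi (0 : ℝ)))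
    (ν := volume.restrict E) hG hr hfin
  rw [heq, ← ENNReal.rpow_inv_le_iff hr0, ← one_div]
  refine hmink.trans (setLIntegral_mono' measurableSet_Ioi fun u hu => ?_)
  rw [one_div, ENNReal.rpow_inv_le_iff hr0]
  simp only [hGr]
  exact (setLIntegral_le_lintegral _ _).trans (hF.lintegral_exp_mul_spectralDensity_le hpq hp2 hu)

/-- The weighted `L^q` bound for the spectral density. -/
lemma lintegral_spectralDensity_le (hF : DecaysOnHalfPlanes F)
    (hpq : p.HolderConjugate q) (hp2 : p ≤ 2) :
    ∫⁻ w in Iio (0 : ℝ), ENNReal.ofReal ((1 / (-(p * w))) ^ (q / p)) *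
        ‖spectralDensity F w‖ₑ ^ q ≤
      (∫⁻ u in Ioi (0 : ℝ), ∫⁻ v : ℝ, ‖F ((u : ℂ) + (v : ℂ) * Complex.I)‖ₑ ^ p) ^ (q / p) := by
  let E : ℕ → Set ℝ := fun n => Icc (-(n + 1 : ℝ)) (-(n + 1 : ℝ)⁻¹)
  have hE : ⋃ n, E n = Iio (0 : ℝ) := by
    ext w
    simp only [E, mem_iUnion, mem_Icc, mem_Iio]
    constructor
    · rintro ⟨n, -, h⟩
      exact h.trans_lt (neg_neg_of_pos (by positivity))
    · intro hw
      obtain ⟨n, hn⟩ := exists_nat_ge (max (-w) (-w)⁻¹)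
      have h1 := (le_max_left _ _).trans hn
      have h2 := (le_max_right _ _).trans hn
      refine ⟨n, by linarith, ?_⟩
      have : (n + 1 : ℝ)⁻¹ ≤ -w := by
        rw [inv_le_comm₀ (by positivity) (neg_pos.2 hw)]
        linarith
      linarith
  have hmono : Monotone E := by
    intro m n hmn
    have : (m : ℝ) ≤ n := by exact_mod_cast hmn
    refine Icc_subset_Icc (by linarith) (neg_le_neg ?_)
    gcongr
  rw [← hE, setLIntegral_iUnion_of_directed _ hmono.directed_le]
  exact iSup_le fun n => hF.lintegral_spectralDensity_le_of_compact hpq hp2 isCompact_Icc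
    (hE ▸ subset_iUnion E n)

end DecaysOnHalfPlanes

lemma lintegral_re_add_im_mul_I {Φ : ℂ → ℝ≥0∞} (hΦ : Measurable Φ) :
    ∫⁻ u : ℝ, ∫⁻ v : ℝ, Φ ((u : ℂ) + (v : ℂ) * Complex.I) = ∫⁻ z, Φ z := by
  have hm : Measurable fun x : ℝ × ℝ => Φ ((x.1 : ℂ) + (x.2 : ℂ) * Complex.I) :=
    hΦ.comp (by fun_prop)
  rw [← Complex.volume_preserving_equiv_real_prod.symm.lintegral_comp hΦ,
    Measure.volume_eq_prod, lintegral_prod]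
  · simp only [Complex.measurableEquivRealProd_symm_apply, Complex.mk_eq_add_mul_I]
  · exact (hΦ.comp (MeasurableEquiv.measurable _)).aemeasurable

lemma measurable_indicator_enorm {f : ℂ → ℂ} {s : Set ℂ} (hf : ContinuousOn f s)
    (hs : MeasurableSet s) : Measurable (s.indicator fun z => ‖f z‖ₑ) := by
  classical
  rw [← piecewise_eq_indicator]
  exact ContinuousOn.measurable_piecewise hf.enorm continuousOn_const hs

lemma enorm_le_lintegral_circle {f : ℂ → ℂ} {z : ℂ} {R r : ℝ}
    (hf : DifferentiableOn ℂ f (Metric.ball z R)) (hr0 : 0 < r) (hr : r < R) :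
    ENNReal.ofReal (2 * π) * ‖f z‖ₑ ≤ ∫⁻ θ in Ioo (-π) π, ‖f (circleMap z r θ)‖ₑ := by
  have hd : DiffContOnCl ℂ f (Metric.ball z |r|) := by
    rw [abs_of_pos hr0]
    refine (hf.mono ?_).diffContOnCl_ball (U := Metric.ball z R) ?_
    · exact subset_rfl
    · exact Metric.closedBall_subset_ball hr
  have h := hd.circleAverage
  have hpi : (0 : ℝ) < 2 * π := by positivity
  rw [Real.circleAverage_eq_integral_add (-π),
    intervalIntegral.integral_comp_add_right (fun θ => f (circleMap z r θ)),
    inv_smul_eq_iff₀ hpi.ne', show (0 : ℝ) + -π = -π by ring, show 2 * π + -π = π by ring,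
    intervalIntegral.integral_of_le (by linarith [Real.pi_pos]), integral_Ioc_eq_integral_Ioo] at h
  calc ENNReal.ofReal (2 * π) * ‖f z‖ₑ = ‖(2 * π) • f z‖ₑ := by
        rw [enorm_smul, Real.enorm_of_nonneg hpi.le]
    _ ≤ _ := by
        rw [← h]
        exact enorm_integral_le_lintegral_enorm _

/-- The area form of the mean value inequality. -/
lemma volume_ball_mul_enorm_le {f : ℂ → ℂ} {z : ℂ} {R : ℝ}
    (hf : DifferentiableOn ℂ f (Metric.ball z R)) :
    volume (Metric.ball z R) * ‖f z‖ₑ ≤ ∫⁻ w in Metric.ball z R, ‖f w‖ₑ := by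
  have hB : MeasurableSet (Metric.ball z R) := Metric.isOpen_ball.measurableSet
  have hpolar : ∀ {Φ : ℂ → ℝ≥0∞}, Measurable Φ → ∫⁻ w, Φ w =
      ∫⁻ r in Ioi (0 : ℝ), ∫⁻ θ in Ioo (-π) π, ENNReal.ofReal r * Φ (circleMap z r θ) := by
    intro Φ hΦ
    have hm : Measurable fun x : ℝ × ℝ => ENNReal.ofReal x.1 * Φ (circleMap z x.1 x.2) := by
      refine (ENNReal.measurable_ofReal.comp measurable_fst).mul (hΦ.comp ?_)
      unfold circleMap
      fun_prop
    rw [← (measurePreserving_add_left volume z).lintegral_comp hΦ,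
      ← Complex.lintegral_comp_polarCoord_symm, polarCoord_target,
      Measure.volume_eq_prod, ← Measure.prod_restrict, ← lintegral_prod _ hm.aemeasurable]
    simp only [Complex.polarCoord_symm_apply, circleMap, Complex.exp_mul_I, smul_eq_mul,
      Complex.ofReal_cos, Complex.ofReal_sin]
  rw [mul_comm, ← setLIntegral_const, ← lintegral_indicator hB, ← lintegral_indicator hB,
    hpolar (measurable_const.indicator hB), hpolar (measurable_indicator_enorm hf.continuousOn hB)]
  refine setLIntegral_mono' measurableSet_Ioi fun r (hr0 : 0 < r) => ?_
  rw [lintegral_const_mul' _ _ ENNReal.ofReal_ne_top, lintegral_const_mul' _ _ ENNReal.ofReal_ne_top]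
  gcongr ENNReal.ofReal r * ?_
  by_cases hr : r < R
  · have hmem : ∀ θ, circleMap z r θ ∈ Metric.ball z R := fun θ => by
      rw [Metric.mem_ball, dist_eq_norm, circleMap_sub_center, norm_circleMap_zero,
        abs_of_pos hr0]
      exact hr
    simp only [indicator_of_mem (hmem _)]
    rw [setLIntegral_const, Real.volume_Ioo, mul_comm, sub_neg_eq_add, ← two_mul]
    exact enorm_le_lintegral_circle hf hr0 hr
  · have hmem : ∀ θ, circleMap z r θ ∉ Metric.ball z R := fun θ => by
      rw [Metric.mem_ball, dist_eq_norm, circleMap_sub_center, norm_circleMap_zero,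
        abs_of_pos hr0]
      exact hr
    simp only [indicator_of_notMem (hmem _)]
    exact le_rfl

lemma measurableSet_zero_lt_re : MeasurableSet {z : ℂ | 0 < z.re} :=
  measurableSet_lt measurable_const Complex.measurable_re

lemma lintegral_Ioi_lintegral_enorm_rpow {f : ℂ → ℂ} (hf : ContinuousOn f {z : ℂ | 0 < z.re})
    {p : ℝ} (hp : 0 < p) :
    ∫⁻ u in Ioi (0 : ℝ), ∫⁻ v : ℝ, ‖f ((u : ℂ) + (v : ℂ) * Complex.I)‖ₑ ^ p =
      ∫⁻ z in {z : ℂ | 0 < z.re}, ‖f z‖ₑ ^ p := by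
  have hpow : ∀ z, ({z : ℂ | 0 < z.re}.indicator fun z => ‖f z‖ₑ) z ^ p =
      {z : ℂ | 0 < z.re}.indicator (fun z => ‖f z‖ₑ ^ p) z := fun z => by
    by_cases hz : z ∈ {z : ℂ | 0 < z.re}
    · simp only [indicator_of_mem hz]
    · simp only [indicator_of_notMem hz, ENNReal.zero_rpow_of_pos hp]
  have hΦ : Measurable ({z : ℂ | 0 < z.re}.indicator fun z => ‖f z‖ₑ ^ p) := by
    rw [← funext hpow]
    exact (measurable_indicator_enorm hf measurableSet_zero_lt_re).pow_const p
  rw [← lintegral_indicator measurableSet_zero_lt_re, ← lintegral_re_add_im_mul_I hΦ,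
    ← lintegral_indicator measurableSet_Ioi]
  refine lintegral_congr fun u => ?_
  by_cases hu : u ∈ Ioi (0 : ℝ)
  · rw [indicator_of_mem hu]
    refine lintegral_congr fun v => ?_
    rw [indicator_of_mem (by simpa using hu)]
  · rw [indicator_of_notMem hu, eq_comm, ← lintegral_zero (α := ℝ) (μ := volume)]
    exact lintegral_congr fun v => indicator_of_notMem (by simpa using hu) _

/-- A Bergman function on the right half-plane is bounded on smaller half-planes. -/
lemma exists_norm_le_of_bergman {f : ℂ → ℂ} (hf : DifferentiableOn ℂ f {z : ℂ | 0 < z.re}) {p : ℝ}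
    (hp : 1 ≤ p) (hfin : ∫⁻ z in {z : ℂ | 0 < z.re}, ‖f z‖ₑ ^ p ≠ ⊤)
    {δ : ℝ} (hδ : 0 < δ) : ∃ C : ℝ, ∀ z : ℂ, δ ≤ z.re → ‖f z‖ ≤ C := by
  set I := ∫⁻ z in {z : ℂ | 0 < z.re}, ‖f z‖ₑ ^ p
  set V := volume (Metric.ball (0 : ℂ) δ)
  have hV0 : V ≠ 0 := (Metric.measure_ball_pos _ _ hδ).ne'
  have hVt : V ≠ ⊤ := measure_ball_lt_top.ne
  have hfin' : (V + I) / V ≠ ⊤ := ENNReal.div_ne_top (ENNReal.add_ne_top.2 ⟨hVt, hfin⟩) hV0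
  refine ⟨((V + I) / V).toReal, fun z hz => ?_⟩
  have hsub : Metric.ball z δ ⊆ {z : ℂ | 0 < z.re} := by
    intro w hw
    rw [Metric.mem_ball, dist_eq_norm] at hw
    have h1 := (abs_le.1 (Complex.abs_re_le_norm (w - z))).1
    rw [Complex.sub_re] at h1
    show 0 < w.re
    linarith
  have hVz : volume (Metric.ball z δ) = V := by simp only [V, Complex.volume_ball]
  have hone : ∀ t : ℝ≥0∞, t ≤ 1 + t ^ p := fun t => by
    rcases le_total t 1 with h | h
    · exact h.trans le_self_add
    · refine le_trans ?_ le_add_self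
      simpa using ENNReal.rpow_le_rpow_of_exponent_le h hp
  have hmain : V * ‖f z‖ₑ ≤ V + I := by
    rw [← hVz]
    refine (volume_ball_mul_enorm_le (hf.mono hsub)).trans ?_
    calc ∫⁻ w in Metric.ball z δ, ‖f w‖ₑ
        ≤ ∫⁻ w in Metric.ball z δ, (1 + ‖f w‖ₑ ^ p) := lintegral_mono fun w => hone _
      _ = volume (Metric.ball z δ) + ∫⁻ w in Metric.ball z δ, ‖f w‖ₑ ^ p := by
          rw [lintegral_add_left measurable_const, setLIntegral_const, one_mul]
      _ ≤ _ := by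
          gcongr
          exact lintegral_mono_set hsub
  rw [← toReal_enorm]
  refine ENNReal.toReal_mono hfin' ?_
  rw [ENNReal.le_div_iff_mul_le (Or.inl hV0) (Or.inl hVt), mul_comm]
  exact hmain

/-- Multiplier with quadratic decay, tending to `1` as `n → ∞`. -/
noncomputable def decayMultiplier (n : ℕ) (z : ℂ) : ℂ := ((1 + z / (n + 1)) ^ 2)⁻¹

lemma one_add_sq_div_le_norm_sq (n : ℕ) {z : ℂ} (hz : 0 < z.re) :
    1 + (z.im / (n + 1)) ^ 2 ≤ ‖(1 + z / (n + 1)) ^ 2‖ := by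
  have h : z / (n + 1 : ℂ) = ((z.re / (n + 1) : ℝ) : ℂ) + ((z.im / (n + 1) : ℝ) : ℂ) * Complex.I := by
    conv_lhs => rw [← Complex.re_add_im z]
    push_cast
    ring
  have hx : 0 < z.re / (n + 1 : ℝ) := by positivity
  rw [norm_pow, ← Complex.normSq_eq_norm_sq, h, Complex.normSq_apply]
  simp only [Complex.add_re, Complex.add_im, Complex.one_re, Complex.one_im, Complex.ofReal_re,
    Complex.ofReal_im, Complex.mul_re, Complex.mul_im, Complex.I_re, Complex.I_im]
  nlinarith

lemma one_add_div_sq_ne_zero (n : ℕ) {z : ℂ} (hz : 0 < z.re) : (1 + z / (n + 1)) ^ 2 ≠ 0 := by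
  intro h
  have := one_add_sq_div_le_norm_sq n hz
  rw [h, norm_zero] at this
  nlinarith [sq_nonneg (z.im / (n + 1))]

lemma differentiableOn_decayMultiplier (n : ℕ) :
    DifferentiableOn ℂ (decayMultiplier n) {z : ℂ | 0 < z.re} :=
  DifferentiableOn.inv (by fun_prop) fun _ hz => one_add_div_sq_ne_zero n hz

lemma norm_decayMultiplier_le_one (n : ℕ) {z : ℂ} (hz : 0 < z.re) : ‖decayMultiplier n z‖ ≤ 1 := by
  rw [decayMultiplier, norm_inv]
  refine inv_le_one_of_one_le₀ (le_trans ?_ (one_add_sq_div_le_norm_sq n hz))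
  nlinarith [sq_nonneg (z.im / (n + 1))]

lemma norm_decayMultiplier_le (n : ℕ) {z : ℂ} (hz : 0 < z.re) :
    ‖decayMultiplier n z‖ ≤ (n + 1) ^ 2 * (1 + z.im ^ 2)⁻¹ := by
  rw [decayMultiplier, norm_inv, ← div_eq_mul_inv, le_div_iff₀ (by positivity), inv_mul_le_iff₀
    (norm_pos_iff.2 (one_add_div_sq_ne_zero n hz))]
  calc 1 + z.im ^ 2 ≤ (1 + (z.im / (n + 1)) ^ 2) * (n + 1) ^ 2 := by
        rw [div_pow, add_mul, div_mul_cancel₀ _ (by positivity)]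
        have : (0 : ℝ) ≤ n := n.cast_nonneg
        nlinarith
    _ ≤ _ := by gcongr; exact one_add_sq_div_le_norm_sq n hz

lemma tendsto_decayMultiplier (z : ℂ) :
    Tendsto (fun n : ℕ => decayMultiplier n z) atTop (𝓝 1) := by
  have h : Tendsto (fun n : ℕ => z / (n + 1 : ℂ)) atTop (𝓝 0) := by
    have := (tendsto_one_div_add_atTop_nhds_zero_nat (𝕜 := ℂ)).const_mul z
    simpa [div_eq_mul_inv] using this
  have h2 := ((h.const_add 1).pow 2).inv₀ (by simp)
  simpa [decayMultiplier] using h2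

lemma decaysOnHalfPlanes_mul_decayMultiplier {f : ℂ → ℂ}
    (hf : DifferentiableOn ℂ f {z : ℂ | 0 < z.re})
    (hb : ∀ δ : ℝ, 0 < δ → ∃ C : ℝ, ∀ z : ℂ, δ ≤ z.re → ‖f z‖ ≤ C) (n : ℕ) :
    DecaysOnHalfPlanes fun z => f z * decayMultiplier n z where
  diff := hf.mul (differentiableOn_decayMultiplier n)
  decay δ hδ := by
    obtain ⟨C, hC⟩ := hb δ hδ
    refine ⟨C * (n + 1) ^ 2, fun z hz => ?_⟩
    rw [norm_mul, mul_assoc]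
    have h := hC z hz
    gcongr
    · exact (norm_nonneg _).trans h
    · exact norm_decayMultiplier_le n (hδ.trans_le hz)

/-- The multiplied functions converge in `L^p` of the half-plane. -/
lemma tendsto_eLpNorm_mul_decayMultiplier_sub {f : ℂ → ℂ} {p : ℝ} (hp : 0 < p)
    (hf : MemLp f (ENNReal.ofReal p) (volume.restrict {z : ℂ | 0 < z.re})) :
    Tendsto (fun n : ℕ => eLpNorm ((fun z => f z * decayMultiplier n z) - f) (ENNReal.ofReal p)
      (volume.restrict {z : ℂ | 0 < z.re})) atTop (𝓝 0) := by
  have hp0 : ENNReal.ofReal p ≠ 0 := by simpa using hp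
  simp only [eLpNorm_eq_lintegral_rpow_enorm_toReal hp0 ENNReal.ofReal_ne_top,
    ENNReal.toReal_ofReal hp.le]
  have hfin : ∫⁻ z in {z : ℂ | 0 < z.re}, ‖f z‖ₑ ^ p ≠ ⊤ := by
    have := lintegral_rpow_enorm_lt_top_of_eLpNorm_lt_top hp0 ENNReal.ofReal_ne_top hf.2
    rw [ENNReal.toReal_ofReal hp.le] at this
    exact this.ne
  have hlim : Tendsto (fun n : ℕ => ∫⁻ z in {z : ℂ | 0 < z.re},
      ‖((fun z => f z * decayMultiplier n z) - f) z‖ₑ ^ p) atTop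
      (𝓝 (∫⁻ _ in {z : ℂ | 0 < z.re}, (0 : ℝ≥0∞))) := by
    refine tendsto_lintegral_of_dominated_convergence' (fun z => 2 ^ p * ‖f z‖ₑ ^ p)
      (fun n => ?_) (fun n => ?_) ?_ (Eventually.of_forall fun z => ?_)
    · exact (((hf.1.mul ((differentiableOn_decayMultiplier n).continuousOn.aestronglyMeasurable
        measurableSet_zero_lt_re)).sub hf.1).enorm).pow_const p
    · refine (ae_restrict_iff' measurableSet_zero_lt_re).2 (Eventually.of_forall fun z hz => ?_)
      simp only [Pi.sub_apply]
      rw [← ENNReal.mul_rpow_of_nonneg _ _ hp.le, two_mul]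
      gcongr
      refine (enorm_sub_le).trans (add_le_add ?_ le_rfl)
      rw [enorm_mul]
      refine mul_le_of_le_one_right' ?_
      rw [← ofReal_norm]
      exact ENNReal.ofReal_le_one.2 (norm_decayMultiplier_le_one n hz)
    · rw [lintegral_const_mul' _ _ (by simp)]
      exact ENNReal.mul_ne_top (by simp) hfin
    · have h1 : Tendsto (fun n : ℕ => f z * decayMultiplier n z - f z) atTop (𝓝 0) := by
        simpa using ((tendsto_decayMultiplier z).const_mul (f z)).sub_const (f z)
      have h2 := (h1.enorm).ennrpow_const p
      simpa [ENNReal.zero_rpow_of_pos hp] using h2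
  rw [lintegral_zero] at hlim
  have := hlim.ennrpow_const (1 / p)
  rwa [ENNReal.zero_rpow_of_pos (by positivity)] at this

/-- The spectral density times the weight `(-p w)^(-1/p)`. -/
noncomputable def weightedDensity (p : ℝ) (F : ℂ → ℂ) (w : ℝ) : ℂ :=
  (((1 / (-(p * w))) ^ (1 / p) : ℝ) : ℂ) * spectralDensity F w

lemma enorm_weight_rpow {p q w : ℝ} (hp : 0 < p) (hq : 0 < q) (hw : w < 0) :
    ‖(((1 / (-(p * w))) ^ (1 / p) : ℝ) : ℂ)‖ₑ ^ q = ENNReal.ofReal ((1 / (-(p * w))) ^ (q / p)) := by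
  have h : 0 < 1 / (-(p * w)) := by
    rw [one_div]; exact inv_pos.2 (neg_pos.2 (mul_neg_of_pos_of_neg hp hw))
  rw [← ofReal_norm, Complex.norm_real, Real.norm_of_nonneg (by positivity),
    ENNReal.ofReal_rpow_of_nonneg (by positivity) hq.le, ← Real.rpow_mul h.le]
  congr 2; ring

namespace DecaysOnHalfPlanes

variable {F : ℂ → ℂ} {p q : ℝ}

lemma aestronglyMeasurable_weightedDensity (hF : DecaysOnHalfPlanes F) (p : ℝ) (ν : Measure ℝ) :
    AEStronglyMeasurable (weightedDensity p F) ν := by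
  refine Measurable.aestronglyMeasurable ?_
  unfold weightedDensity
  exact (by fun_prop : Measurable fun w : ℝ => (((1 / (-(p * w))) ^ (1 / p) : ℝ) : ℂ)).mul
    hF.continuous_spectralDensity.measurable

lemma eLpNorm_weightedDensity_le (hF : DecaysOnHalfPlanes F)
    (hpq : p.HolderConjugate q) (hp2 : p ≤ 2) :
    eLpNorm (weightedDensity p F) (ENNReal.ofReal q) (volume.restrict (Iio 0)) ≤
      eLpNorm F (ENNReal.ofReal p) (volume.restrict {z : ℂ | 0 < z.re}) := by
  have hp0 := hpq.pos
  have hq0 := hpq.symm.pos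
  rw [eLpNorm_eq_lintegral_rpow_enorm_toReal (by simpa using hq0) ENNReal.ofReal_ne_top,
    eLpNorm_eq_lintegral_rpow_enorm_toReal (by simpa using hp0) ENNReal.ofReal_ne_top,
    ENNReal.toReal_ofReal hp0.le, ENNReal.toReal_ofReal hq0.le,
    ← lintegral_Ioi_lintegral_enorm_rpow hF.diff.continuousOn hp0]
  have h := ENNReal.rpow_le_rpow (hF.lintegral_spectralDensity_le hpq hp2)
    (one_div_nonneg.2 hq0.le)
  rw [← ENNReal.rpow_mul, show q / p * (1 / q) = 1 / p by field_simp] at h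
  refine le_trans (le_of_eq ?_) h
  congr 1
  refine setLIntegral_congr_fun measurableSet_Iio fun w hw => ?_
  simp only [weightedDensity]
  rw [enorm_mul, ENNReal.mul_rpow_of_nonneg _ _ hq0.le, enorm_weight_rpow hp0 hq0 hw]

end DecaysOnHalfPlanes

lemma weightedDensity_sub {F G : ℂ → ℂ} (hF : DecaysOnHalfPlanes F) (hG : DecaysOnHalfPlanes G)
    (p : ℝ) : weightedDensity p (F - G) = weightedDensity p F - weightedDensity p G := by
  ext w
  simp only [weightedDensity, Pi.sub_apply, hF.spectralDensity_sub hG, mul_sub]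

/-- The Laplace kernel divided by the weight belongs to `L^p`. -/
lemma memLp_exp_mul_weight_inv {p : ℝ} (hp : 0 < p) {z : ℂ} (hz : 0 < z.re) :
    MemLp (fun w : ℝ => Complex.exp (z * w) * (((1 / (-(p * w))) ^ (1 / p) : ℝ) : ℂ)⁻¹)
      (ENNReal.ofReal p) (volume.restrict (Iio 0)) := by
  refine ⟨Measurable.aestronglyMeasurable (by fun_prop), ?_⟩
  rw [eLpNorm_lt_top_iff_lintegral_rpow_enorm_lt_top (by simpa using hp) ENNReal.ofReal_ne_top,
    ENNReal.toReal_ofReal hp.le]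
  have hint : IntegrableOn (fun w : ℝ => 2 / z.re * Real.exp (p * z.re / 2 * w)) (Iio 0) :=
    ((integrableOn_exp_mul_Iic (by positivity) 0).mono_set Iio_subset_Iic_self).const_mul _
  refine lt_of_le_of_lt (setLIntegral_mono' measurableSet_Iio fun w (hw : w < 0) => ?_)
    hint.lintegral_lt_top
  have hpw : 0 < -(p * w) := neg_pos.2 (mul_neg_of_pos_of_neg hp hw)
  rw [← ofReal_norm, norm_mul, norm_inv, Complex.norm_real, Complex.norm_exp,
    Real.norm_of_nonneg (by positivity), ENNReal.ofReal_rpow_of_nonneg (by positivity) hp.le]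
  refine ENNReal.ofReal_le_ofReal ?_
  rw [Real.mul_rpow (by positivity) (by positivity), Real.inv_rpow (by positivity),
    ← Real.rpow_mul (by positivity), one_div_mul_cancel hp.ne', Real.rpow_one, one_div, inv_inv,
    ← Real.exp_mul, Complex.re_mul_ofReal]
  have h1 : -(p * w) * z.re / 2 ≤ Real.exp (-(p * w) * z.re / 2) := by
    linarith [Real.add_one_le_exp (-(p * w) * z.re / 2)]
  have h2 : -(p * w) ≤ 2 / z.re * Real.exp (-(p * w) * z.re / 2) := by
    rw [div_mul_eq_mul_div, le_div_iff₀ hz]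
    linarith
  calc Real.exp (z.re * w * p) * -(p * w)
      ≤ Real.exp (z.re * w * p) * (2 / z.re * Real.exp (-(p * w) * z.re / 2)) := by gcongr
    _ = 2 / z.re * Real.exp (p * z.re / 2 * w) := by
      rw [mul_left_comm, ← Real.exp_add]
      congr 2; ring

/-- `L^q` limit of the weighted densities of an `L^p`-approximating sequence, together with the
Laplace representation of the limit function. -/
lemma exists_weightedDensity_limit {p q : ℝ} (hpq : p.HolderConjugate q) (hp2 : p ≤ 2)
    {f : ℂ → ℂ} (hf : MemLp f (ENNReal.ofReal p) (volume.restrict {z : ℂ | 0 < z.re}))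
    {F : ℕ → ℂ → ℂ} (hF : ∀ n, DecaysOnHalfPlanes (F n))
    (hle : ∀ n, ∀ z : ℂ, 0 < z.re → ‖F n z‖ ≤ ‖f z‖)
    (hFf : Tendsto (fun n => eLpNorm (F n - f) (ENNReal.ofReal p)
      (volume.restrict {z : ℂ | 0 < z.re})) atTop (𝓝 0))
    (hpt : ∀ z : ℂ, 0 < z.re → Tendsto (fun n => F n z) atTop (𝓝 (f z))) :
    ∃ K : ℝ → ℂ, Measurable K ∧
      eLpNorm K (ENNReal.ofReal q) (volume.restrict (Iio 0)) ≤
        eLpNorm f (ENNReal.ofReal p) (volume.restrict {z : ℂ | 0 < z.re}) ∧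
      ∀ z : ℂ, 0 < z.re → f z = (Real.sqrt (2 * π) : ℂ)⁻¹ * ∫ w in Iio (0 : ℝ),
        (Complex.exp (z * w) * (((1 / (-(p * w))) ^ (1 / p) : ℝ) : ℂ)⁻¹) * K w := by
  set μ := volume.restrict {z : ℂ | 0 < z.re}
  set ν := volume.restrict (Iio (0 : ℝ))
  have hp0 := hpq.pos
  have hq0 := hpq.symm.pos
  have : Fact (1 ≤ ENNReal.ofReal p) := ⟨ENNReal.one_le_ofReal.2 hpq.lt.le⟩
  have : Fact (1 ≤ ENNReal.ofReal q) := ⟨ENNReal.one_le_ofReal.2 hpq.symm.lt.le⟩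
  have := hpq.ennrealOfReal
  have hFle : ∀ n, eLpNorm (F n) (ENNReal.ofReal p) μ ≤ eLpNorm f (ENNReal.ofReal p) μ := fun n =>
    eLpNorm_mono_ae ((ae_restrict_iff' measurableSet_zero_lt_re).2
      (Eventually.of_forall fun z hz => hle n z hz))
  have hFm : ∀ n, MemLp (F n) (ENNReal.ofReal p) μ := fun n =>
    ⟨(hF n).diff.continuousOn.aestronglyMeasurable measurableSet_zero_lt_re,
      (hFle n).trans_lt hf.2⟩
  have hkle : ∀ n, eLpNorm (weightedDensity p (F n)) (ENNReal.ofReal q) ν ≤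
      eLpNorm f (ENNReal.ofReal p) μ := fun n =>
    ((hF n).eLpNorm_weightedDensity_le hpq hp2).trans (hFle n)
  have hk : ∀ n, MemLp (weightedDensity p (F n)) (ENNReal.ofReal q) ν := fun n =>
    ⟨(hF n).aestronglyMeasurable_weightedDensity p ν, (hkle n).trans_lt hf.2⟩
  have hFc : CauchySeq fun n => (hFm n).toLp (F n) :=
    ((Lp.tendsto_Lp_iff_tendsto_eLpNorm'' F hFm f hf).2 hFf).cauchySeq
  have hkc : CauchySeq fun n => (hk n).toLp (weightedDensity p (F n)) := by
    rw [EMetric.cauchySeq_iff] at hFc ⊢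
    intro ε hε
    obtain ⟨N, hN⟩ := hFc ε hε
    refine ⟨N, fun m hm n hn => lt_of_le_of_lt ?_ (hN m hm n hn)⟩
    rw [Lp.edist_toLp_toLp, Lp.edist_toLp_toLp, ← weightedDensity_sub (hF m) (hF n)]
    exact ((hF m).sub (hF n)).eLpNorm_weightedDensity_le hpq hp2
  obtain ⟨K, hK⟩ := cauchySeq_tendsto_of_complete hkc
  have hKm := (Lp.aestronglyMeasurable K)
  refine ⟨hKm.mk K, hKm.stronglyMeasurable_mk.measurable, ?_, fun z hz => ?_⟩
  · rw [← eLpNorm_congr_ae hKm.ae_eq_mk, ← Lp.enorm_def]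
    refine le_of_tendsto hK.enorm (Eventually.of_forall fun n => ?_)
    rw [Lp.enorm_toLp]
    exact hkle n
  · have hφ := memLp_exp_mul_weight_inv hp0 hz
    set φ : ℝ → ℂ := fun w => Complex.exp (z * w) * (((1 / (-(p * w))) ^ (1 / p) : ℝ) : ℂ)⁻¹
    let T := (ContinuousLinearMap.mul ℂ ℂ).lpPairing ν (ENNReal.ofReal p) (ENNReal.ofReal q)
      (hφ.toLp φ)
    have hT : ∀ {h : ℝ → ℂ} (L : Lp ℂ (ENNReal.ofReal q) ν), L =ᵐ[ν] h →
        T L = ∫ w, φ w * h w ∂ν := fun {h} L hL => by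
      simp only [T]
      rw [ContinuousLinearMap.lpPairing_eq_integral]
      refine integral_congr_ae ?_
      filter_upwards [hL, hφ.coeFn_toLp] with w h1 h2
      rw [h1, h2, ContinuousLinearMap.mul_apply']
    have h1 : ∀ n, F n z = (Real.sqrt (2 * π) : ℂ)⁻¹ *
        T ((hk n).toLp (weightedDensity p (F n))) := fun n => by
      rw [hT _ (hk n).coeFn_toLp, (hF n).eq_integral_spectralDensity hz]
      congr 1
      refine setIntegral_congr_fun measurableSet_Iio fun w (hw : w < 0) => ?_
      have hpw : 0 < -(p * w) := neg_pos.2 (mul_neg_of_pos_of_neg hp0 hw)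
      have hne : (((1 / (-(p * w))) ^ (1 / p) : ℝ) : ℂ) ≠ 0 :=
        Complex.ofReal_ne_zero.2 (by positivity)
      simp only [φ, weightedDensity]
      rw [mul_assoc, inv_mul_cancel_left₀ hne]
    rw [← hT K hKm.ae_eq_mk]
    refine tendsto_nhds_unique (hpt z hz) ?_
    simp only [h1]
    exact ((T.continuous.tendsto K).comp hK).const_mul _

end FourierBergman


theorem Bergman_PaleyWiener_1_lt_p_le_2 (p q : ℝ) (hp1 : 1 < p) (hp2 : p ≤ 2)
    (hq : q = p / (p - 1))
    (f : ℂ → ℂ) (hf : DifferentiableOn ℂ f {z : ℂ | 0 < z.re})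
    (M : ℝ) (hM0 : 0 ≤ M)
    (hM : (∫⁻ u in Set.Ioi (0 : ℝ),
        ∫⁻ v : ℝ, (‖f ((u : ℂ) + (v : ℂ) * Complex.I)‖₊ : ℝ≥0∞) ^ p) =
      ENNReal.ofReal (M ^ p)) :
    ∃ g : ℝ → ℂ, Measurable g ∧
      (∀ z : ℂ, 0 < z.re →
        f z = (Real.sqrt (2 * Real.pi) : ℂ)⁻¹ *
          ∫ w in Set.Iio (0 : ℝ), Complex.exp (z * (w : ℂ)) * g w) ∧
      (∫⁻ w in Set.Iio (0 : ℝ),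
          ENNReal.ofReal ((1 / (-(p * w))) ^ (q / p)) * (‖g w‖₊ : ℝ≥0∞) ^ q) ≤
        ENNReal.ofReal (M ^ q) := by
  have hpq : p.HolderConjugate q := (Real.holderConjugate_iff_eq_conjExponent hp1).2 hq
  have hp0 := hpq.pos
  have hq0 := hpq.symm.pos
  have hp0' : ENNReal.ofReal p ≠ 0 := (ENNReal.ofReal_pos.2 hp0).ne'
  have hq0' : ENNReal.ofReal q ≠ 0 := (ENNReal.ofReal_pos.2 hq0).ne'
  have hI : ∫⁻ z in {z : ℂ | 0 < z.re}, ‖f z‖ₑ ^ p = ENNReal.ofReal (M ^ p) := by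
    rw [← lintegral_Ioi_lintegral_enorm_rpow hf.continuousOn hp0, ← hM]
    rfl
  have hnorm : eLpNorm f (ENNReal.ofReal p) (volume.restrict {z : ℂ | 0 < z.re}) =
      ENNReal.ofReal M := by
    rw [eLpNorm_eq_lintegral_rpow_enorm_toReal hp0' ENNReal.ofReal_ne_top,
      ENNReal.toReal_ofReal hp0.le, hI, ← ENNReal.ofReal_rpow_of_nonneg hM0 hp0.le,
      ← ENNReal.rpow_mul, mul_one_div_cancel hp0.ne', ENNReal.rpow_one]
  have hfm : MemLp f (ENNReal.ofReal p) (volume.restrict {z : ℂ | 0 < z.re}) :=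
    ⟨hf.continuousOn.aestronglyMeasurable measurableSet_zero_lt_re, by
      rw [hnorm]; exact ENNReal.ofReal_lt_top⟩
  have hb := fun (δ : ℝ) (hδ : 0 < δ) => exists_norm_le_of_bergman hf hp1.le
    (by rw [hI]; exact ENNReal.ofReal_ne_top) hδ
  obtain ⟨K, hKm, hKle, hKf⟩ := exists_weightedDensity_limit hpq hp2 hfm
    (decaysOnHalfPlanes_mul_decayMultiplier hf hb)
    (fun n z hz => by
      rw [norm_mul]
      exact mul_le_of_le_one_right (norm_nonneg _) (norm_decayMultiplier_le_one n hz))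
    (tendsto_eLpNorm_mul_decayMultiplier_sub hp0 hfm)
    (fun z _ => by simpa using (tendsto_decayMultiplier z).const_mul (f z))
  refine ⟨fun w => (((1 / (-(p * w))) ^ (1 / p) : ℝ) : ℂ)⁻¹ * K w, by fun_prop, fun z hz => ?_, ?_⟩
  · rw [hKf z hz]
    simp only [mul_assoc]
  · calc _ = ∫⁻ w in Iio (0 : ℝ), ‖K w‖ₑ ^ q := by
          refine setLIntegral_congr_fun measurableSet_Iio fun w (hw : w < 0) => ?_
          have hpw : 0 < -(p * w) := neg_pos.2 (mul_neg_of_pos_of_neg hp0 hw)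
          have hne : (((1 / (-(p * w))) ^ (1 / p) : ℝ) : ℂ) ≠ 0 :=
            Complex.ofReal_ne_zero.2 (by positivity)
          simp only [← enorm_eq_nnnorm]
          rw [← enorm_weight_rpow hp0 hq0 hw, ← ENNReal.mul_rpow_of_nonneg _ _ hq0.le,
            ← enorm_mul, mul_inv_cancel_left₀ hne]
      _ = eLpNorm K (ENNReal.ofReal q) (volume.restrict (Iio 0)) ^ q := by
          rw [eLpNorm_eq_lintegral_rpow_enorm_toReal hq0' ENNReal.ofReal_ne_top,
            ENNReal.toReal_ofReal hq0.le, ← ENNReal.rpow_mul, one_div_mul_cancel hq0.ne',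
            ENNReal.rpow_one]
      _ ≤ ENNReal.ofReal M ^ q := by rw [← hnorm]; gcongr
      _ = ENNReal.ofReal (M ^ q) := ENNReal.ofReal_rpow_of_nonneg hM0 hq0.le
end

section
/- Let f : ℂ → ℂ be holomorphic on the open right half-plane Π₊ = {z ∈ ℂ : 0 < Re z} with M := ∫_0^∞ ∫_ℝ |f(u+iv)| dv du < ∞. Then there exists a measurable function g : (-∞,0) → ℂ such that f(z) = (1/√(2π)) ∫_{-∞}^0 e^{zw} g(w) dw for every z with Re z > 0, and |g(w)| ≤ (−w) · M for almost every w < 0. -/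
open MeasureTheory Set
open scoped ENNReal NNReal

/-- The integrals of a holomorphic function along the two vertical sides of a strip agree, provided
the function is integrable on both sides and on the strip. -/
theorem integral_vertical_line_eq_of_integrable_strip {F : ℂ → ℂ} {a b : ℝ}
    (hF : DifferentiableOn ℂ F {z : ℂ | z.re ∈ uIcc a b})
    (ha : Integrable fun v : ℝ => F (a + v * Complex.I))
    (hb : Integrable fun v : ℝ => F (b + v * Complex.I))
    (hab : Integrable (fun p : ℝ × ℝ => F (p.1 + p.2 * Complex.I))
      ((volume.restrict (uIoc a b)).prod volume)) :
    ∫ v : ℝ, F (a + v * Complex.I) = ∫ v : ℝ, F (b + v * Complex.I) := by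
  set φ : ℝ → ℂ := fun v => ∫ x in a..b, F (x + v * Complex.I) with hφ
  have hφi : Integrable φ := by
    simp only [hφ, intervalIntegral.intervalIntegral_eq_integral_uIoc]
    exact hab.integral_prod_right.smul _
  have hrect (R : ℝ) : φ (-R) - φ R =
      -Complex.I * ((∫ v in (-R)..R, F (b + v * Complex.I)) -
        ∫ v in (-R)..R, F (a + v * Complex.I)) := by
    have h := Complex.integral_boundary_rect_eq_zero_of_differentiableOn F
      (a + (-R : ℝ) * Complex.I) (b + R * Complex.I)
      (hF.mono fun z hz => by simpa using hz.1)
    simp only [Complex.add_re, Complex.add_im, Complex.mul_re, Complex.mul_im, Complex.ofReal_re,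
      Complex.ofReal_im, Complex.I_re, Complex.I_im, mul_zero, mul_one, sub_zero,
      add_zero, zero_add, smul_eq_mul] at h
    simp only [hφ]
    linear_combination h
  have hlim : Filter.Tendsto (fun R => φ (-R) - φ R) Filter.atTop
      (nhds (-Complex.I * ((∫ v : ℝ, F (b + v * Complex.I)) -
        ∫ v : ℝ, F (a + v * Complex.I)))) := by
    simp only [hrect]
    exact ((intervalIntegral_tendsto_integral hb Filter.tendsto_neg_atTop_atBot
      Filter.tendsto_id).sub (intervalIntegral_tendsto_integral ha Filter.tendsto_neg_atTop_atBot
      Filter.tendsto_id)).const_mul _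
  have h0 := IntegrableAtFilter.eq_zero_of_tendsto
    ((hφi.comp_neg.sub hφi).integrableAtFilter Filter.atTop) (fun s hs => by
      obtain ⟨c, hc⟩ := Filter.mem_atTop_sets.1 hs
      rw [← top_le_iff, ← Real.volume_Ici (a := c)]
      exact measure_mono hc) hlim
  have h1 := (mul_eq_zero.1 h0).resolve_left (neg_ne_zero.2 Complex.I_ne_zero)
  exact (sub_eq_zero.1 h1).symm

/-- Fourier inversion on the real line in the angular frequency normalization. -/
theorem integral_exp_mul_integral_exp_neg_mul {φ : ℝ → ℂ} (hc : Continuous φ)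
    (hi : Integrable φ)
    (hI : Integrable fun w : ℝ => ∫ t : ℝ, Complex.exp (-(t * w * Complex.I)) * φ t) (v : ℝ) :
    ∫ w : ℝ, Complex.exp (v * w * Complex.I) *
      ∫ t : ℝ, Complex.exp (-(t * w * Complex.I)) * φ t = 2 * Real.pi * φ v := by
  set ψ : ℝ → ℂ := fun w => ∫ t : ℝ, Complex.exp (-(t * w * Complex.I)) * φ t with hψ
  have hpi : (0 : ℝ) < 2 * Real.pi := by positivity
  have hF : FourierTransform.fourier φ = fun ξ => ψ (2 * Real.pi * ξ) := by
    ext ξ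
    rw [Real.fourier_real_eq_integral_exp_smul]
    refine integral_congr_ae (.of_forall fun t => ?_)
    simp only [smul_eq_mul]
    congr 2
    push_cast
    ring
  have hinv := congrFun (hc.fourierInv_fourier_eq hi (by
    rw [hF]; exact hI.comp_mul_left' hpi.ne')) v
  rw [Real.fourierInv_eq', hF] at hinv
  have hsub := Measure.integral_comp_mul_left
    (fun w : ℝ => Complex.exp (v * w * Complex.I) * ψ w) (2 * Real.pi)
  have : (∫ x : ℝ, Complex.exp (v * (2 * Real.pi * x : ℝ) * Complex.I) * ψ (2 * Real.pi * x)) =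
      φ v := by
    rw [← hinv]
    refine integral_congr_ae (.of_forall fun t => ?_)
    simp only [smul_eq_mul, RCLike.inner_apply, conj_trivial]
    congr 2
    push_cast
    ring
  rw [this, abs_of_pos (inv_pos.2 hpi)] at hsub
  have hpi' : (2 * Real.pi : ℂ) ≠ 0 := by exact_mod_cast hpi.ne'
  rw [hsub, Complex.real_smul, Complex.ofReal_inv, Complex.ofReal_mul, Complex.ofReal_ofNat,
    mul_inv_cancel_left₀ hpi']

theorem integrableOn_exp_mul_mul_neg_Iio {a : ℝ} (ha : 0 < a) :
    IntegrableOn (fun w : ℝ => Real.exp (a * w) * -w) (Iio 0) := by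
  have h2 : 0 < a / 2 := by positivity
  refine Integrable.mono' (((integrableOn_exp_mul_Iic h2 0).mono_set Iio_subset_Iic_self).const_mul
    (2 / a)) (by fun_prop) ?_
  filter_upwards [ae_restrict_mem measurableSet_Iio] with w (hw : w < 0)
  rw [Real.norm_of_nonneg (mul_nonneg (Real.exp_pos _).le (by linarith))]
  have h1 : -w ≤ 2 / a * Real.exp (-(a / 2 * w)) := by
    rw [div_mul_eq_mul_div, le_div_iff₀ ha]
    linarith [Real.add_one_le_exp (-(a / 2 * w))]
  calc Real.exp (a * w) * -w ≤ Real.exp (a * w) * (2 / a * Real.exp (-(a / 2 * w))) := by gcongr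
    _ = 2 / a * (Real.exp (a * w) * Real.exp (-(a / 2 * w))) := by ring
    _ = 2 / a * Real.exp (a / 2 * w) := by
      rw [← Real.exp_add]
      ring_nf

/-- The Laplace integral of a function of at most linear growth on the negative half-line is
continuous in the real part of the argument. -/
theorem continuousOn_integral_exp_mul_Iio {h : ℝ → ℂ} (hh : Measurable h) {M : ℝ}
    (hb : ∀ w < 0, ‖h w‖ ≤ -w * M) (v : ℝ) :
    ContinuousOn (fun u : ℝ => ∫ w in Iio (0 : ℝ),
      Complex.exp ((u + v * Complex.I) * w) * h w) (Ioi 0) := by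
  intro u (hu : 0 < u)
  refine (continuousAt_of_dominated (bound := fun w => Real.exp (u / 2 * w) * -w * M)
    (.of_forall fun u' => ?_) ?_ ((integrableOn_exp_mul_mul_neg_Iio (half_pos hu)).mul_const M)
    (.of_forall fun w => by fun_prop)).continuousWithinAt
  · exact (Measurable.aestronglyMeasurable (by fun_prop))
  · filter_upwards [lt_mem_nhds (half_lt_self hu)] with u' hu'
    filter_upwards [ae_restrict_mem measurableSet_Iio] with w (hw : w < 0)
    rw [norm_mul, Complex.norm_exp, mul_assoc]
    have : (((u' : ℂ) + v * Complex.I) * w).re = u' * w := by simp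
    rw [this]
    exact mul_le_mul (Real.exp_le_exp.2 (by nlinarith)) (hb w hw) (norm_nonneg _)
      (Real.exp_pos _).le

theorem integral_norm_le_of_lintegral_prod {F : ℝ × ℝ → ℂ} {s : Set ℝ}
    (hF : AEStronglyMeasurable F ((volume.restrict s).prod volume)) {M : ℝ} (hM0 : 0 ≤ M)
    (hM : ∫⁻ u in s, ∫⁻ v : ℝ, ‖F (u, v)‖ₑ = ENNReal.ofReal M) :
    Integrable F ((volume.restrict s).prod volume) ∧ ∫ u in s, ∫ v : ℝ, ‖F (u, v)‖ = M := by
  have hl : ∫⁻ p, ‖F p‖ₑ ∂((volume.restrict s).prod volume) = ENNReal.ofReal M := by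
    rw [lintegral_prod _ hF.enorm, hM]
  have hi : Integrable F ((volume.restrict s).prod volume) :=
    ⟨hF, by rw [HasFiniteIntegral, hl]; exact ENNReal.ofReal_lt_top⟩
  refine ⟨hi, ?_⟩
  rw [← integral_prod _ hi.norm, integral_norm_eq_lintegral_enorm hF, hl,
    ENNReal.toReal_ofReal hM0]

theorem Bergman_PaleyWiener_p_eq_one (f : ℂ → ℂ)
    (hf : DifferentiableOn ℂ f {z : ℂ | 0 < z.re})
    (M : ℝ) (hM0 : 0 ≤ M)
    (hM : (∫⁻ u in Set.Ioi (0 : ℝ),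
        ∫⁻ v : ℝ, (‖f ((u : ℂ) + (v : ℂ) * Complex.I)‖₊ : ℝ≥0∞)) =
      ENNReal.ofReal M) :
    ∃ g : ℝ → ℂ, Measurable g ∧
      (∀ z : ℂ, 0 < z.re →
        f z = (Real.sqrt (2 * Real.pi) : ℂ)⁻¹ *
          ∫ w in Set.Iio (0 : ℝ), Complex.exp (z * (w : ℂ)) * g w) ∧
      (∀ᵐ w ∂(volume.restrict (Set.Iio (0 : ℝ))), ‖g w‖ ≤ (-w) * M) := by
  have hfc : ContinuousOn (fun p : ℝ × ℝ => f (p.1 + p.2 * Complex.I)) (Ioi 0 ×ˢ univ) :=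
    hf.continuousOn.comp (by fun_prop) fun p hp => by simpa using hp.1
  have hfm : AEStronglyMeasurable (fun p : ℝ × ℝ => f (p.1 + p.2 * Complex.I))
      ((volume.restrict (Ioi 0)).prod volume) := by
    have := hfc.aestronglyMeasurable (μ := (volume : Measure ℝ).prod volume)
      (measurableSet_Ioi.prod .univ)
    rwa [← Measure.prod_restrict, Measure.restrict_univ] at this
  obtain ⟨hfi, hfM⟩ := integral_norm_le_of_lintegral_prod hfm hM0 hM
  set N : ℝ → ℝ := fun u => ∫ v : ℝ, ‖f (u + v * Complex.I)‖ with hN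
  have hNi : IntegrableOn N (Ioi 0) := hfi.integral_norm_prod_left
  have hline (u : ℝ) (hu : 0 < u) : Continuous fun v : ℝ => f (u + v * Complex.I) :=
    hf.continuousOn.comp_continuous (by fun_prop) fun v => by simpa using hu
  set S : Set ℝ := {u | 0 < u ∧ Integrable fun v : ℝ => f (u + v * Complex.I)} with hS
  have hSae : ∀ᵐ u ∂(volume.restrict (Ioi (0 : ℝ))), u ∈ S := by
    filter_upwards [hfi.prod_right_ae, ae_restrict_mem measurableSet_Ioi] with u h1 h2
    exact ⟨h2, h1⟩
  obtain ⟨u₀, hu₀⟩ : ∃ u, u ∈ S := by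
    have : NeZero (volume.restrict (Ioi (0 : ℝ))) := ⟨by simp [Measure.restrict_eq_zero]⟩
    exact hSae.exists
  have hexp (u v w : ℝ) : ‖Complex.exp (-((u + v * Complex.I) * w))‖ = Real.exp (-(u * w)) := by
    rw [Complex.norm_exp]
    simp
  have hSi (u : ℝ) (hu : u ∈ S) (w : ℝ) :
      Integrable fun v : ℝ => Complex.exp (-((u + v * Complex.I) * w)) * f (u + v * Complex.I) :=
    hu.2.bdd_mul (c := Real.exp (-(u * w))) (Continuous.aestronglyMeasurable (by fun_prop))
      (.of_forall fun v => (hexp u v w).le)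
  set h : ℝ → ℂ := fun w =>
    ∫ v : ℝ, Complex.exp (-((u₀ + v * Complex.I) * w)) * f (u₀ + v * Complex.I) with hh
  have hSh (u : ℝ) (hu : u ∈ S) (w : ℝ) :
      h w = ∫ v : ℝ, Complex.exp (-((u + v * Complex.I) * w)) * f (u + v * Complex.I) := by
    have hpos : ∀ x ∈ uIcc u₀ u, 0 < x := fun x hx => (lt_min hu₀.1 hu.1).trans_le hx.1
    refine integral_vertical_line_eq_of_integrable_strip
      (F := fun z => Complex.exp (-(z * w)) * f z) ?_ (hSi u₀ hu₀ w) (hSi u hu w) ?_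
    · exact DifferentiableOn.mul (by fun_prop) (hf.mono fun z hz => hpos _ hz)
    · have hle : (volume.restrict (uIoc u₀ u)).prod (volume : Measure ℝ) ≤
          (volume.restrict (Ioi 0)).prod volume :=
        Measure.prod_mono (Measure.restrict_mono (fun x hx => hpos x (uIoc_subset_uIcc hx)) le_rfl)
          le_rfl
      obtain ⟨C, hC⟩ := (isCompact_uIcc (a := u₀) (b := u)).exists_bound_of_continuousOn
        (f := fun x : ℝ => Real.exp (-(x * w))) (by fun_prop)
      refine (hfi.mono_measure hle).bdd_mul (c := C)
        (Continuous.aestronglyMeasurable (by fun_prop)) ?_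
      have : ∀ᵐ p ∂((volume.restrict (uIoc u₀ u)).prod (volume : Measure ℝ)), p.1 ∈ uIoc u₀ u :=
        Measure.quasiMeasurePreserving_fst.ae (ae_restrict_mem measurableSet_uIoc)
      filter_upwards [this] with p hp
      rw [hexp]
      exact (le_abs_self _).trans (hC _ (uIoc_subset_uIcc hp))
  have hhm : Measurable h := by
    have hc := hline u₀ hu₀.1
    refine (StronglyMeasurable.integral_prod_right' (f := fun p : ℝ × ℝ =>
      Complex.exp (-((u₀ + p.2 * Complex.I) * p.1)) * f (u₀ + p.2 * Complex.I))
      (Continuous.stronglyMeasurable ?_)).measurable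
    exact Continuous.mul (by fun_prop) (hc.comp continuous_snd)
  have hhN (w u : ℝ) (hu : u ∈ S) : ‖h w‖ * Real.exp (u * w) ≤ N u := by
    have : ‖h w‖ ≤ Real.exp (-(u * w)) * N u := by
      rw [hSh u hu w, hN, ← integral_const_mul]
      refine (norm_integral_le_integral_norm _).trans_eq ?_
      simp only [norm_mul, hexp]
    calc ‖h w‖ * Real.exp (u * w) ≤ Real.exp (-(u * w)) * N u * Real.exp (u * w) := by gcongr
      _ = N u := by rw [mul_right_comm, ← Real.exp_add]; simp
  have hneg (w : ℝ) (hw : w < 0) : ‖h w‖ ≤ -w * M := by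
    have h1 : ∫ u in Ioi (0 : ℝ), ‖h w‖ * Real.exp (w * u) ≤ ∫ u in Ioi (0 : ℝ), N u := by
      refine integral_mono_ae ((integrableOn_exp_mul_Ioi hw 0).const_mul _) hNi ?_
      filter_upwards [hSae] with u hu
      simpa only [mul_comm w u] using hhN w u hu
    rw [hfM, integral_const_mul, integral_exp_mul_Ioi hw] at h1
    simp only [mul_zero, Real.exp_zero] at h1
    rwa [neg_div, ← div_neg, mul_one_div, div_le_iff₀ (neg_pos.2 hw), mul_comm] at h1
  have hnonneg (w : ℝ) (hw : 0 ≤ w) : h w = 0 := by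
    have h1 : IntegrableOn (fun _ : ℝ => h w) (Ioi 0) := by
      refine Integrable.mono' hNi aestronglyMeasurable_const ?_
      filter_upwards [hSae] with u hu
      exact (le_mul_of_one_le_right (norm_nonneg _)
        (Real.one_le_exp (mul_nonneg hu.1.le hw))).trans (hhN w u hu)
    simpa [integrableOn_const_iff] using h1
  have hinvS (v u : ℝ) (hu : u ∈ S) : 2 * Real.pi * f (u + v * Complex.I) =
      ∫ w in Iio (0 : ℝ), Complex.exp ((u + v * Complex.I) * w) * h w := by
    have hψ (w : ℝ) : ∫ t : ℝ, Complex.exp (-(t * w * Complex.I)) * f (u + t * Complex.I) =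
        Complex.exp (u * w) * h w := by
      rw [hSh u hu w, ← integral_const_mul]
      refine integral_congr_ae (.of_forall fun t => ?_)
      simp only [← mul_assoc, ← Complex.exp_add]
      congr 2
      ring
    have hψi : Integrable fun w : ℝ => Complex.exp (u * w) * h w := by
      rw [← integrableOn_iff_integrable_of_support_subset (s := Iio 0)]
      · refine Integrable.mono' ((integrableOn_exp_mul_mul_neg_Iio hu.1).mul_const M)
          (Measurable.aestronglyMeasurable (by fun_prop)) ?_
        filter_upwards [ae_restrict_mem measurableSet_Iio] with w hw
        rw [norm_mul, ← Complex.ofReal_mul, Complex.norm_exp_ofReal, mul_assoc]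
        gcongr
        exact hneg w hw
      · refine Function.support_subset_iff'.2 fun w hw => ?_
        rw [hnonneg w (not_lt.1 hw), mul_zero]
    have key := integral_exp_mul_integral_exp_neg_mul (hline u hu.1) hu.2
      (by simpa only [hψ] using hψi) v
    rw [← key, setIntegral_eq_integral_of_forall_compl_eq_zero fun w hw => by
      rw [hnonneg w (not_lt.1 hw), mul_zero]]
    refine integral_congr_ae (.of_forall fun w => ?_)
    simp only [hψ, ← mul_assoc, ← Complex.exp_add]
    congr 2
    ring
  have hinv (v u : ℝ) (hu : 0 < u) : 2 * Real.pi * f (u + v * Complex.I) =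
      ∫ w in Iio (0 : ℝ), Complex.exp ((u + v * Complex.I) * w) * h w := by
    refine Measure.eqOn_open_of_ae_eq (μ := volume) (U := Ioi 0)
      (f := fun u : ℝ => 2 * Real.pi * f (u + v * Complex.I)) ?_ isOpen_Ioi ?_
      (continuousOn_integral_exp_mul_Iio hhm hneg v) hu
    · filter_upwards [hSae] with u hu using hinvS v u hu
    · exact continuousOn_const.mul (hf.continuousOn.comp (by fun_prop) fun u hu => by simpa using hu)
  have hsq : (Real.sqrt (2 * Real.pi) : ℂ) * Real.sqrt (2 * Real.pi) = 2 * Real.pi := by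
    rw [← Complex.ofReal_mul, Real.mul_self_sqrt (by positivity)]
    push_cast
    rfl
  refine ⟨fun w => (Real.sqrt (2 * Real.pi) : ℂ)⁻¹ * h w, hhm.const_mul _, fun z hz => ?_, ?_⟩
  · have hz' := hinv z.im z.re hz
    rw [Complex.re_add_im] at hz'
    simp only [mul_left_comm _ (Real.sqrt (2 * Real.pi) : ℂ)⁻¹]
    rw [integral_const_mul, ← hz', ← mul_assoc, ← mul_inv, hsq, inv_mul_cancel_left₀]
    simp [Real.pi_ne_zero]
  · filter_upwards [ae_restrict_mem measurableSet_Iio] with w hw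
    rw [norm_mul, norm_inv, Complex.norm_real, Real.norm_of_nonneg (Real.sqrt_nonneg _)]
    refine (mul_le_of_le_one_left (norm_nonneg _) (inv_le_one_of_one_le₀ ?_)).trans (hneg w hw)
    rw [Real.one_le_sqrt]
    linarith [Real.pi_gt_three]
end

section
/- Let g : (-∞,0) → ℂ be measurable with ∫_{-∞}^0 |g(w)|² (−w)^{−1} dw < ∞, and define f(z) = (1/√(2π)) ∫_{-∞}^0 e^{zw} g(w) dw for Re z > 0. Then f is holomorphic on the open right half-plane Π₊ = {z ∈ ℂ : 0 < Re z} and ∫_0^∞ ∫_ℝ |f(u+iv)|² dv du ≤ (1/2) ∫_{-∞}^0 |g(w)|² (−w)^{−1} dw. -/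
open MeasureTheory Set
open scoped ENNReal NNReal

section Plancherel

open FourierTransform ContDiff

variable {V F : Type*} [NormedAddCommGroup V] [InnerProductSpace ℝ V] [FiniteDimensional ℝ V]
  [MeasurableSpace V] [BorelSpace V] [NormedAddCommGroup F] [InnerProductSpace ℂ F]
  [CompleteSpace F]

/-- For a function in `L¹ ∩ L²`, the `L²` Fourier transform is given by the Fourier integral. -/
theorem MeasureTheory.MemLp.coeFn_fourier_toLp {f : V → F} (h1 : Integrable f)
    (h2 : MemLp f 2) : (𝓕 (h2.toLp f) : Lp F 2 (volume : Measure V)) =ᵐ[volume] 𝓕 f := by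
  refine ae_eq_of_integral_contDiff_smul_eq ((Lp.memLp _).locallyIntegrable (by norm_num))
    (VectorFourier.fourierIntegral_continuous Real.continuous_fourierChar
      (innerSL ℝ).continuous₂ h1).locallyIntegrable fun φ hφ hφc ↦ ?_
  have hc : HasCompactSupport (Complex.ofRealCLM ∘ φ) := hφc.comp_left rfl
  have hd : ContDiff ℝ ∞ (Complex.ofRealCLM ∘ φ) := by fun_prop
  let ψ : SchwartzMap V ℂ := hc.toSchwartzMap hd
  have hψφ (x : V) : ψ x = (φ x : ℂ) := rfl
  have hL2 : ∫ x, ψ x • (𝓕 (h2.toLp f) : Lp F 2 (volume : Measure V)) x =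
      ∫ x, 𝓕 ψ x • (h2.toLp f) x := by
    rw [← Lp.toTemperedDistribution_apply, ← Lp.toTemperedDistribution_apply,
      ← Lp.fourier_toTemperedDistribution_eq, TemperedDistribution.fourier_apply]
  have hL1 : ∫ x, 𝓕 (ψ : V → ℂ) x • f x = ∫ x, ψ x • 𝓕 f x :=
    VectorFourier.integral_fourierIntegral_smul_eq_flip (L := innerₗ V)
      Real.continuous_fourierChar continuous_inner ψ.integrable h1 |>.trans (by
        simp only [flip_innerₗ]; rfl)
  have hcoe : ∫ x, 𝓕 ψ x • (h2.toLp f) x = ∫ x, 𝓕 (ψ : V → ℂ) x • f x := by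
    refine integral_congr_ae ?_
    filter_upwards [h2.coeFn_toLp] with x hx
    rw [hx, SchwartzMap.fourier_coe]
  simpa only [hψφ, Complex.coe_smul] using hL2.trans (hcoe.trans hL1)

/-- **Plancherel's theorem** for functions in `L¹ ∩ L²`. -/
theorem MeasureTheory.MemLp.eLpNorm_fourier {f : V → F} (h1 : Integrable f) (h2 : MemLp f 2) :
    eLpNorm (𝓕 f) 2 = eLpNorm f 2 := by
  rw [← eLpNorm_congr_ae (h2.coeFn_fourier_toLp h1), ← Lp.enorm_def,
    ← eLpNorm_congr_ae h2.coeFn_toLp, ← Lp.enorm_def, ← ofReal_norm, ← ofReal_norm,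
    Lp.norm_fourier_eq]

theorem MeasureTheory.MemLp.lintegral_enorm_sq_fourier {f : V → F} (h1 : Integrable f)
    (h2 : MemLp f 2) : ∫⁻ x, ‖𝓕 f x‖ₑ ^ 2 = ∫⁻ x, ‖f x‖ₑ ^ 2 := by
  have h (k : V → F) : eLpNorm k 2 ^ 2 = ∫⁻ x, ‖k x‖ₑ ^ 2 := by
    simpa using eLpNorm_nnreal_pow_eq_lintegral (f := k) (μ := volume) (p := 2) two_ne_zero
  rw [← h, ← h, h2.eLpNorm_fourier h1]

end Plancherel

theorem lintegral_comp_mul_left_real (F : ℝ → ℝ≥0∞) {a : ℝ} (ha : a ≠ 0) :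
    ∫⁻ x, F (a * x) = ENNReal.ofReal |a⁻¹| * ∫⁻ x, F x := by
  have := (Homeomorph.mulLeft₀ a ha).measurableEmbedding.lintegral_map F (μ := volume)
  simp only [Homeomorph.coe_mulLeft₀] at this
  rw [← this, Real.map_volume_mul_left ha, lintegral_smul_measure, smul_eq_mul]

theorem lintegral_exp_mul_Ioi {a : ℝ} (ha : a < 0) :
    ∫⁻ u in Ioi (0 : ℝ), ENNReal.ofReal (Real.exp (a * u)) = ENNReal.ofReal (-a)⁻¹ := by
  rw [← ofReal_integral_eq_lintegral_ofReal (integrableOn_exp_mul_Ioi ha 0)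
    (Filter.Eventually.of_forall fun _ ↦ (Real.exp_pos _).le), integral_exp_mul_Ioi ha 0]
  congr 1
  simp [inv_neg, neg_div]

theorem enorm_exp_mul_sq (z : ℂ) (w : ℝ) (c : ℂ) :
    ‖Complex.exp (z * w) * c‖ₑ ^ 2 =
      ENNReal.ofReal (Real.exp (2 * w * z.re)) * ‖c‖ₑ ^ 2 := by
  rw [enorm_mul, mul_pow, ← ofReal_norm (Complex.exp _), Complex.norm_exp,
    ← ENNReal.ofReal_pow (Real.exp_pos _).le, ← Real.exp_nat_mul]
  have : (z * w).re = z.re * w := by simp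
  rw [this]
  congr 3
  push_cast
  ring

section

variable {g : ℝ → ℂ}

theorem integrableOn_exp_mul_Iio (hgm : Measurable g)
    (hg : ∫⁻ w in Iio (0 : ℝ), ‖g w‖ₑ ^ 2 * ENNReal.ofReal (-w)⁻¹ < ⊤) {z : ℂ} (hz : 0 < z.re) :
    IntegrableOn (fun w : ℝ ↦ Complex.exp (z * w) * g w) (Iio 0) := by
  have hG : IntegrableOn (fun w : ℝ ↦ ‖g w‖ ^ 2 * (-w)⁻¹) (Iio 0) := by
    refine ⟨by fun_prop, ?_⟩
    rw [hasFiniteIntegral_iff_enorm]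
    refine lt_of_eq_of_lt (setLIntegral_congr_fun measurableSet_Iio fun w hw ↦ ?_) hg
    have hw' : 0 ≤ (-w)⁻¹ := inv_nonneg.2 (neg_nonneg.2 (le_of_lt hw))
    simp only [enorm_mul, enorm_pow, enorm_norm, Real.enorm_of_nonneg hw']
  have hE : IntegrableOn (fun w : ℝ ↦ (-w) * Real.exp (2 * z.re * w)) (Iio 0) := by
    have h := integrableOn_rpow_mul_exp_neg_mul_rpow (p := 1) (s := 1) (b := 2 * z.re)
      (by norm_num) one_pos (by positivity)
    simp only [Real.rpow_one] at h
    have h' := h.comp_neg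
    simpa using h'
  refine ((hG.add hE).const_mul (1 / 2)).mono' (by fun_prop) ?_
  refine (ae_restrict_iff' measurableSet_Iio).2 (Filter.Eventually.of_forall fun w hw ↦ ?_)
  have hw' : 0 < -w := neg_pos.2 hw
  have hexp : Real.exp (2 * z.re * w) = Real.exp (z.re * w) ^ 2 := by
    rw [← Real.exp_nat_mul]; congr 1; push_cast; ring
  have hre : (z * w).re = z.re * w := by simp
  simp only [Pi.add_apply, norm_mul, Complex.norm_exp, hre, hexp]
  have hsq : ‖g w‖ ^ 2 * (-w)⁻¹ + -w * Real.exp (z.re * w) ^ 2 -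
      2 * (Real.exp (z.re * w) * ‖g w‖) =
      (‖g w‖ - (-w) * Real.exp (z.re * w)) ^ 2 * (-w)⁻¹ := by
    have : w ≠ 0 := hw.ne
    field_simp
    ring
  have : 0 ≤ (‖g w‖ - (-w) * Real.exp (z.re * w)) ^ 2 * (-w)⁻¹ := by positivity
  linarith

theorem memLp_two_exp_mul_Iio (hgm : Measurable g)
    (hg : ∫⁻ w in Iio (0 : ℝ), ‖g w‖ₑ ^ 2 * ENNReal.ofReal (-w)⁻¹ < ⊤) {z : ℂ} (hz : 0 < z.re) :
    MemLp (fun w : ℝ ↦ Complex.exp (z * w) * g w) 2 (volume.restrict (Iio 0)) := by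
  refine ⟨by fun_prop, ?_⟩
  rw [eLpNorm_lt_top_iff_lintegral_rpow_enorm_lt_top two_ne_zero ENNReal.ofNat_ne_top]
  simp only [ENNReal.toReal_ofNat, ENNReal.rpow_ofNat]
  refine lt_of_le_of_lt (setLIntegral_mono (by fun_prop) fun w hw ↦ ?_)
    ((lintegral_const_mul (ENNReal.ofReal (2 * z.re)⁻¹) (by fun_prop)).trans_lt
      (ENNReal.mul_lt_top ENNReal.ofReal_lt_top hg))
  have hw' : 0 < -w := neg_pos.2 hw
  rw [enorm_exp_mul_sq, mul_left_comm, mul_comm, ← ENNReal.ofReal_mul (by positivity)]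
  gcongr
  rw [← mul_inv, le_inv_comm₀ (Real.exp_pos _) (by positivity), ← Real.exp_neg]
  linarith [Real.add_one_le_exp (-(2 * w * z.re))]

theorem hasDerivAt_integral_exp_mul_Iio (hgm : Measurable g)
    (hg : ∫⁻ w in Iio (0 : ℝ), ‖g w‖ₑ ^ 2 * ENNReal.ofReal (-w)⁻¹ < ⊤) {z : ℂ} (hz : 0 < z.re) :
    HasDerivAt (fun z : ℂ ↦ ∫ w in Iio (0 : ℝ), Complex.exp (z * w) * g w)
      (∫ w in Iio (0 : ℝ), w * Complex.exp (z * w) * g w) z := by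
  set ε := z.re / 4 with hε
  have hε0 : 0 < ε := by positivity
  have hs : {y : ℂ | 2 * ε < y.re} ∈ nhds z :=
    (isOpen_lt continuous_const Complex.continuous_re).mem_nhds (by simp; linarith)
  refine (hasDerivAt_integral_of_dominated_loc_of_deriv_le
    (μ := volume.restrict (Iio 0)) (F := fun (z : ℂ) (w : ℝ) ↦ Complex.exp (z * w) * g w)
    (F' := fun (z : ℂ) (w : ℝ) ↦ w * Complex.exp (z * w) * g w)
    (bound := fun w : ℝ ↦ ε⁻¹ * ‖Complex.exp ((ε : ℂ) * w) * g w‖) hs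
    (Filter.Eventually.of_forall fun y ↦ by fun_prop) (integrableOn_exp_mul_Iio hgm hg hz)
    (by fun_prop) ?_ ?_ ?_).2
  · refine (ae_restrict_iff' measurableSet_Iio).2 (Filter.Eventually.of_forall fun w hw y hy ↦ ?_)
    have hw' : w < 0 := hw
    have hy' : 2 * ε < y.re := hy
    have hre : (y * w).re = y.re * w := by simp
    have hre' : ((ε : ℂ) * w).re = ε * w := by simp
    simp only [norm_mul, Complex.norm_exp, hre, hre', Complex.norm_real, Real.norm_eq_abs,
      abs_of_neg hw', ← mul_assoc]
    refine mul_le_mul_of_nonneg_right ?_ (norm_nonneg _)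
    have h1 : Real.exp (y.re * w) ≤ Real.exp (ε * w) * Real.exp (ε * w) := by
      rw [← Real.exp_add]
      exact Real.exp_le_exp.2 (by nlinarith)
    have h2 : -w * Real.exp (ε * w) ≤ ε⁻¹ := by
      rw [← le_div_iff₀ (Real.exp_pos _), div_eq_mul_inv, ← Real.exp_neg, inv_mul_eq_div,
        le_div_iff₀ hε0]
      linarith [Real.add_one_le_exp (-(ε * w))]
    calc -w * Real.exp (y.re * w)
        ≤ -w * (Real.exp (ε * w) * Real.exp (ε * w)) := by gcongr; linarith
      _ = -w * Real.exp (ε * w) * Real.exp (ε * w) := by ring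
      _ ≤ ε⁻¹ * Real.exp (ε * w) := by gcongr
  · exact (integrableOn_exp_mul_Iio hgm hg (z := (ε : ℂ)) (by simpa)).norm.const_mul _
  · refine Filter.Eventually.of_forall fun w y _ ↦ ?_
    simpa [mul_comm] using (((hasDerivAt_id y).mul_const (w : ℂ)).cexp).mul_const (g w)

open FourierTransform in
/-- Plancherel's theorem on a vertical line for the Laplace-type transform of `g`. -/
theorem lintegral_enorm_sq_integral_exp_mul_Iio (hgm : Measurable g)
    (hg : ∫⁻ w in Iio (0 : ℝ), ‖g w‖ₑ ^ 2 * ENNReal.ofReal (-w)⁻¹ < ⊤) {u : ℝ} (hu : 0 < u) :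
    ∫⁻ v : ℝ, ‖(Real.sqrt (2 * Real.pi) : ℂ)⁻¹ *
        ∫ w in Iio (0 : ℝ), Complex.exp (((u : ℂ) + v * Complex.I) * w) * g w‖ₑ ^ 2 =
      ∫⁻ w in Iio (0 : ℝ), ENNReal.ofReal (Real.exp (2 * w * u)) * ‖g w‖ₑ ^ 2 := by
  set h : ℝ → ℂ := (Iio 0).indicator fun w : ℝ ↦ Complex.exp ((u : ℂ) * w) * g w with hh
  have h1 : Integrable h := (integrable_indicator_iff measurableSet_Iio).2
    (integrableOn_exp_mul_Iio hgm hg (z := u) (by simpa))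
  have h2 : MemLp h 2 := (memLp_indicator_iff_restrict measurableSet_Iio).2
    (memLp_two_exp_mul_Iio hgm hg (z := u) (by simpa))
  have hpi : (0 : ℝ) < 2 * Real.pi := by positivity
  have key (v : ℝ) : ∫ w in Iio (0 : ℝ), Complex.exp (((u : ℂ) + v * Complex.I) * w) * g w =
      𝓕 h (-(2 * Real.pi)⁻¹ * v) := by
    rw [Real.fourier_real_eq_integral_exp_smul, ← integral_indicator measurableSet_Iio]
    congr 1 with w
    by_cases hw : w ∈ Iio (0 : ℝ)
    · simp only [hh, indicator_of_mem hw, smul_eq_mul, ← mul_assoc, ← Complex.exp_add]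
      congr 2
      push_cast
      field_simp
      ring
    · simp [hh, indicator_of_notMem hw]
  have hc : ‖(Real.sqrt (2 * Real.pi) : ℂ)⁻¹‖ₑ ^ 2 = ENNReal.ofReal (2 * Real.pi)⁻¹ := by
    rw [← ofReal_norm, ← ENNReal.ofReal_pow (norm_nonneg _), norm_inv, Complex.norm_real,
      Real.norm_of_nonneg (Real.sqrt_nonneg _), inv_pow, Real.sq_sqrt hpi.le]
  simp_rw [key, enorm_mul, mul_pow, hc]
  rw [lintegral_const_mul' _ _ ENNReal.ofReal_ne_top,
    lintegral_comp_mul_left_real (fun x ↦ ‖𝓕 h x‖ₑ ^ 2) (neg_ne_zero.2 (inv_ne_zero hpi.ne')),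
    h2.lintegral_enorm_sq_fourier h1, ← mul_assoc, ← ENNReal.ofReal_mul (by positivity),
    inv_neg, inv_inv, abs_neg, abs_of_pos hpi, inv_mul_cancel₀ hpi.ne', ENNReal.ofReal_one,
    one_mul, ← lintegral_indicator measurableSet_Iio]
  congr 1 with w
  by_cases hw : w ∈ Iio (0 : ℝ)
  · simp only [hh, indicator_of_mem hw, enorm_exp_mul_sq, Complex.ofReal_re]
  · simp [hh, indicator_of_notMem hw]

theorem lintegral_lintegral_exp_mul_Iio (hgm : Measurable g) :
    ∫⁻ u in Ioi (0 : ℝ), ∫⁻ w in Iio (0 : ℝ),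
        ENNReal.ofReal (Real.exp (2 * w * u)) * ‖g w‖ₑ ^ 2 =
      ENNReal.ofReal (1 / 2) *
        ∫⁻ w in Iio (0 : ℝ), ‖g w‖ₑ ^ 2 * ENNReal.ofReal (-w)⁻¹ := by
  rw [lintegral_lintegral_swap (by fun_prop), ← lintegral_const_mul _ (by fun_prop)]
  refine setLIntegral_congr_fun measurableSet_Iio fun w hw ↦ ?_
  have hw' : w < 0 := hw
  rw [lintegral_mul_const _ (by fun_prop), lintegral_exp_mul_Ioi (by linarith), mul_left_comm,
    mul_comm, ← ENNReal.ofReal_mul (by norm_num)]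
  congr 2
  rw [← mul_neg, mul_inv, one_div]

end

theorem Bergman_converse_PaleyWiener_B2 (g : ℝ → ℂ) (hgm : Measurable g)
    (hg : (∫⁻ w in Set.Iio (0 : ℝ),
        (‖g w‖₊ : ℝ≥0∞) ^ 2 * ENNReal.ofReal (-w)⁻¹) < ⊤)
    (f : ℂ → ℂ)
    (hf : ∀ z : ℂ, 0 < z.re →
      f z = (Real.sqrt (2 * Real.pi) : ℂ)⁻¹ *
        ∫ w in Set.Iio (0 : ℝ), Complex.exp (z * (w : ℂ)) * g w) :
    DifferentiableOn ℂ f {z : ℂ | 0 < z.re} ∧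
      (∫⁻ u in Set.Ioi (0 : ℝ),
          ∫⁻ v : ℝ, (‖f ((u : ℂ) + (v : ℂ) * Complex.I)‖₊ : ℝ≥0∞) ^ 2) ≤
        ENNReal.ofReal (1 / 2) *
          ∫⁻ w in Set.Iio (0 : ℝ), (‖g w‖₊ : ℝ≥0∞) ^ 2 * ENNReal.ofReal (-w)⁻¹ := by
  simp only [← enorm_eq_nnnorm] at hg ⊢
  refine ⟨DifferentiableOn.congr (fun z hz ↦ ((hasDerivAt_integral_exp_mul_Iio hgm hg
    hz).const_mul _).differentiableAt.differentiableWithinAt) hf, ?_⟩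
  rw [← lintegral_lintegral_exp_mul_Iio hgm]
  refine (setLIntegral_congr_fun measurableSet_Ioi fun u hu ↦ ?_).le
  have hu' : 0 < u := hu
  rw [← lintegral_enorm_sq_integral_exp_mul_Iio hgm hg hu']
  refine lintegral_congr fun v ↦ ?_
  rw [hf _ (by simpa)]
end
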